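/- arXiv:2209.06045 — 2 statements merged into one kernel-verified Lean document; each statement's English description precedes it below -/
import Mathlib

section
/- Upper bounds for ε_n(α,τ) under Besov regularity of the truth (Lemma 3.3(ii)): Let 1 ≤ p ≤ q < 2, α, τ > 0, and let Π(·|α,τ) be the α-regular τ-scaled p-exponential prior. Fix K > 0 and let ε_n(α,τ) be the unique solution of Π(θ : ‖θ−θ₀‖₂ ≤ Kε_n|α,τ) = e^{−nε_n²}. Suppose θ₀ ∈ B^β_{qq} with β ≥ 1/p. Define ε̃_n(α,τ) = n^{−α/(1+2α)}τ^{1/(1+2α)} + (nτ^p)^{−(2βq+q−2)/(4βq+4q−4−2βpq+2αpq)} if β < α+1/p; ε̃_n(α,τ) = n^{−α/(1+2α)}τ^{1/(1+2α)} + (nτ^p)^{−1/2} if β > α+1/p; and ε̃_n(α,τ) = n^{−α/(1+2α)}τ^{1/(1+2α)} + (nτ^p)^{−1/2}[log(√(nτ^p))]^{(q−p)/(2q)} if β = α+1/p. Then for any C̃, L > 0 there exists a constant C > 0, depending on θ₀ only through ‖θ₀‖_{B^β_{qq}} ≤ L and chosen uniformly over all τ with ε_n(α,τ)/τ ≤ C̃,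 such that ε_n(α,τ) ≤ C ε̃_n(α,τ) for all n. -/
noncomputable section

open MeasureTheory ProbabilityTheory Filter Set

/-- The index `ℓ = i + 1 ≥ 1` associated to the coordinate `i : ℕ`. -/
def idx (i : ℕ) : ℝ := (i : ℝ) + 1

/-- The `p`-exponential probability density on `ℝ`:
`f_p(x) = exp(−|x|^p/p) / (2 Γ(1/p) p^{1/p−1})`. -/
def pexpDensity (p x : ℝ) : ℝ :=
  Real.exp (-|x| ^ p / p) / (2 * Real.Gamma (1 / p) * p ^ (1 / p - 1))

/-- The `p`-exponential probability measure on `ℝ`. -/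
def pexpMeasure (p : ℝ) : Measure ℝ :=
  MeasureTheory.volume.withDensity fun x => ENNReal.ofReal (pexpDensity p x)

/-- The law of the `i`-th coordinate `τ ℓ^{−1/2−α} ξ` (with `ℓ = i+1`) of a draw from the
`α`-regular `τ`-scaled `p`-exponential prior. -/
def coordLaw (p α τ : ℝ) (i : ℕ) : Measure ℝ :=
  (pexpMeasure p).map fun x => τ * idx i ^ (-(1 / 2 : ℝ) - α) * x

/-- `μ` is the `α`-regular `τ`-scaled `p`-exponential prior on `ℝ^ℕ`: the joint law of the
independent coordinates `τ ℓ^{−1/2−α} ξ_ℓ` with `ξ_ℓ` i.i.d. `p`-exponential. -/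
def IsPexpPrior (p α τ : ℝ) (μ : Measure (ℕ → ℝ)) : Prop :=
  IsProbabilityMeasure μ ∧
  IsProjectiveLimit μ fun I : Finset ℕ => Measure.pi fun i : I => coordLaw p α τ i

/-- `μ` is the Gaussian sequence model measure `P^n_θ`: the joint law of independent
coordinates `X_ℓ ~ N(θ_ℓ, 1/n)`. -/
def IsGaussModel (n : ℕ) (θ : ℕ → ℝ) (μ : Measure (ℕ → ℝ)) : Prop :=
  IsProbabilityMeasure μ ∧
  IsProjectiveLimit μ fun I : Finset ℕ =>
    Measure.pi fun i : I => gaussianReal (θ i) ((n : NNReal))⁻¹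

/-- The `ℓ₂` norm of a sequence (with the `tsum` junk-value convention). -/
def l2norm (θ : ℕ → ℝ) : ℝ := Real.sqrt (∑' i, θ i ^ 2)

/-- Membership in the Sobolev ball `H^β(L)`. -/
def inSobolevBall (β L : ℝ) (θ : ℕ → ℝ) : Prop :=
  Summable (fun i => idx i ^ (2 * β) * θ i ^ 2) ∧
    Real.sqrt (∑' i, idx i ^ (2 * β) * θ i ^ 2) ≤ L

/-- The log-likelihood `ℓ_n(θ) = n Σ_ℓ X_ℓ θ_ℓ − (n/2) ‖θ‖₂²` in the Gaussian sequence model. -/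
def loglik (n : ℕ) (θ X : ℕ → ℝ) : ℝ :=
  (n : ℝ) * (∑' i, X i * θ i) - (n : ℝ) / 2 * ∑' i, θ i ^ 2

/-- The likelihood ratio `p^n_θ(X) = dP^n_θ/dP^n_0 (X)`. -/
def lik (n : ℕ) (θ X : ℕ → ℝ) : ℝ := Real.exp (loglik n θ X)

/-- The marginal likelihood of the data `X` for the prior `prior`. -/
def marginalLik (n : ℕ) (prior : Measure (ℕ → ℝ)) (X : ℕ → ℝ) : ℝ :=
  ∫ θ, lik n θ X ∂prior

/-- The posterior mass of a set `B` given data `X`, for the prior `prior`. -/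
def post (n : ℕ) (prior : Measure (ℕ → ℝ)) (X : ℕ → ℝ) (B : Set (ℕ → ℝ)) : ℝ :=
  (∫ θ in B, lik n θ X ∂prior) / marginalLik n prior X

/-- Membership in the Besov ball `B^β_{qq}(L)`. -/
def inBesovBall (β q L : ℝ) (θ : ℕ → ℝ) : Prop :=
  Summable (fun i => idx i ^ (q * β + q / 2 - 1) * |θ i| ^ q) ∧
    (∑' i, idx i ^ (q * β + q / 2 - 1) * |θ i| ^ q) ^ (1 / q) ≤ L

/-- The upper bound `ε̃_n(α,τ)` of Lemma 3.3(ii), for a Besov `B^β_{qq}` truth, `p ≤ q < 2`. -/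
def epsTildeBesov (p q α β : ℝ) (n : ℕ) (τ : ℝ) : ℝ :=
  (n : ℝ) ^ (-(α / (1 + 2 * α))) * τ ^ (1 / (1 + 2 * α)) +
    (if β < α + 1 / p then
      ((n : ℝ) * τ ^ p) ^
        (-((2 * β * q + q - 2) / (4 * β * q + 4 * q - 4 - 2 * β * p * q + 2 * α * p * q)))
     else if α + 1 / p < β then ((n : ℝ) * τ ^ p) ^ (-(1 / 2) : ℝ)
     else ((n : ℝ) * τ ^ p) ^ (-(1 / 2) : ℝ) *
       Real.log (Real.sqrt ((n : ℝ) * τ ^ p)) ^ ((q - p) / (2 * q)))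

theorem half_prod_le_infinitePi (ν : ℕ → Measure ℝ) [∀ i, IsProbabilityMeasure (ν i)]
    (F : Finset ℕ) {A : ℕ → Set ℝ} (hA : ∀ i, MeasurableSet (A i))
    {g : ℕ → ℝ → ENNReal} (hg : ∀ i, Measurable (g i)) {ρ : ENNReal} (hρ0 : ρ ≠ 0) (hρt : ρ ≠ ⊤)
    (hsum : ∑' i, (if i ∈ F then 0 else ∫⁻ x, g i x ∂(ν i)) ≤ ρ / 2) :
    (∏ i ∈ F, ν i (A i)) / 2 ≤ Measure.infinitePi ν
      {θ | (∀ i ∈ F, θ i ∈ A i) ∧ ∑' i, (if i ∈ F then 0 else g i (θ i)) ≤ ρ} := by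
  classical
  set μ := Measure.infinitePi ν with hμ
  set B : Set (ℕ → ℝ) := Set.pi F A with hB
  have hBm : MeasurableSet B := MeasurableSet.pi F.countable_toSet fun i _ => hA i
  have hBμ : μ B = ∏ i ∈ F, ν i (A i) := Measure.infinitePi_pi ν fun i _ => hA i
  set Y : (ℕ → ℝ) → ENNReal := fun θ => ∑' i, (if i ∈ F then 0 else g i (θ i)) with hY
  have hterm : ∀ i, Measurable fun θ : ℕ → ℝ => if i ∈ F then (0 : ENNReal) else g i (θ i) := by
    intro i
    split_ifs
    · exact measurable_const
    · exact (hg i).comp (measurable_pi_apply i)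
  have hYm : Measurable Y := Measurable.tsum hterm
  have hcoord : ∀ i ∉ F, ∫⁻ θ in B, g i (θ i) ∂μ = μ B * ∫⁻ x, g i x ∂(ν i) := by
    intro i hi
    let X : ℕ → ℝ → ENNReal := fun j => if j ∈ F then (A j).indicator 1 else g j
    have hX : ∀ j, Measurable (X j) := by
      intro j
      by_cases hj : j ∈ F
      · simp only [X, hj, if_true]
        exact measurable_one.indicator (hA j)
      · simp only [X, hj, if_false]
        exact hg j
    have hind : iIndepFun (fun j (θ : ℕ → ℝ) => X j (θ j)) μ := iIndepFun_infinitePi hX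
    have hmeas : ∀ j, Measurable fun θ : ℕ → ℝ => X j (θ j) :=
      fun j => (hX j).comp (measurable_pi_apply j)
    have h1 := lintegral_mul_eq_lintegral_mul_lintegral_of_indepFun
      (Finset.measurable_prod F fun j _ => hmeas j) (hmeas i)
      (by simpa [Finset.prod_fn] using hind.indepFun_finsetProd_of_notMem hmeas hi)
    have h2 : (fun θ : ℕ → ℝ => ∏ j ∈ F, X j (θ j)) = B.indicator 1 := by
      funext θ
      by_cases hθ : θ ∈ B
      · rw [Set.indicator_of_mem hθ]
        refine Finset.prod_eq_one fun j hj => ?_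
        have hj' : θ j ∈ A j := hθ j hj
        simp [X, hj, hj']
      · rw [Set.indicator_of_notMem hθ]
        have : ∃ j ∈ F, θ j ∉ A j := by
          by_contra! hcon
          exact hθ fun j hj => hcon j hj
        obtain ⟨j, hj, hj'⟩ := this
        exact Finset.prod_eq_zero hj (by simp [X, hj, hj'])
    have h3 : ∀ θ : ℕ → ℝ, X i (θ i) = g i (θ i) := fun θ => by simp [X, hi]
    rw [h2] at h1
    simp only [Pi.mul_apply, h3] at h1
    rw [lintegral_indicator_one hBm] at h1
    have h4 : ∫⁻ θ, g i (θ i) ∂μ = ∫⁻ x, g i x ∂(ν i) := by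
      rw [← (measurePreserving_eval_infinitePi ν i).lintegral_comp (hg i)]
    rw [← h4, ← h1, ← lintegral_indicator hBm]
    congr 1
    funext θ
    by_cases hθ : θ ∈ B <;> simp [hθ]
  have hBY : ∫⁻ θ in B, Y θ ∂μ ≤ μ B * (ρ / 2) := by
    rw [hY, lintegral_tsum fun i => (hterm i).aemeasurable]
    calc ∑' i, ∫⁻ θ in B, (if i ∈ F then (0 : ENNReal) else g i (θ i)) ∂μ
        = ∑' i, μ B * (if i ∈ F then 0 else ∫⁻ x, g i x ∂(ν i)) := by
          congr 1
          funext i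
          by_cases hi : i ∈ F
          · simp [hi]
          · simp only [hi, if_false]
            exact hcoord i hi
      _ = μ B * ∑' i, (if i ∈ F then 0 else ∫⁻ x, g i x ∂(ν i)) := ENNReal.tsum_mul_left
      _ ≤ μ B * (ρ / 2) := by gcongr
  have hmarkov : μ (B ∩ {θ | ρ ≤ Y θ}) ≤ μ B / 2 := by
    have h := mul_meas_ge_le_lintegral (μ := μ.restrict B) hYm ρ
    rw [Measure.restrict_apply (measurableSet_le measurable_const hYm), Set.inter_comm] at h
    have h' : ρ * μ (B ∩ {θ | ρ ≤ Y θ}) ≤ ρ * (μ B / 2) := by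
      refine (h.trans hBY).trans (le_of_eq ?_)
      rw [div_eq_mul_inv, div_eq_mul_inv]
      ring
    exact (ENNReal.mul_le_mul_iff_right hρ0 hρt).1 h'
  have hsub : B ⊆ {θ | (∀ i ∈ F, θ i ∈ A i) ∧ Y θ ≤ ρ} ∪ (B ∩ {θ | ρ ≤ Y θ}) := by
    intro θ hθ
    rcases le_total (Y θ) ρ with h | h
    · exact Or.inl ⟨fun i hi => hθ i hi, h⟩
    · exact Or.inr ⟨hθ, h⟩
  have hle := (measure_mono hsub).trans (measure_union_le (μ := μ) _ _)
  rw [← hBμ]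
  have hfin : μ B / 2 ≠ ⊤ := (ENNReal.div_lt_top (measure_ne_top μ B) two_ne_zero).ne
  have hle2 : μ B / 2 + μ B / 2 ≤
      μ {θ | (∀ i ∈ F, θ i ∈ A i) ∧ Y θ ≤ ρ} + μ B / 2 := by
    rw [ENNReal.add_halves]
    exact hle.trans (by gcongr)
  exact (ENNReal.add_le_add_iff_right hfin).1 hle2

theorem integrable_comp_abs_of_integrableOn_Ioi {f : ℝ → ℝ} (hf : IntegrableOn f (Ioi 0)) :
    Integrable fun x => f |x| := by
  have hpos : IntegrableOn (fun x => f |x|) (Ioi 0) :=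
    hf.congr_fun (fun x hx => by rw [abs_of_pos (mem_Ioi.1 hx)]) measurableSet_Ioi
  have hneg : IntegrableOn (fun x => f |x|) (Iic 0) := by
    rw [← Measure.map_neg_eq_self (volume : Measure ℝ)]
    let m : MeasurableEmbedding fun x : ℝ => -x := (Homeomorph.neg ℝ).measurableEmbedding
    rw [m.integrableOn_map_iff]
    simp_rw [Function.comp_def, abs_neg, neg_preimage, neg_Iic, neg_zero]
    exact Iff.mpr integrableOn_Ici_iff_integrableOn_Ioi hpos
  rw [← integrableOn_univ, ← Iic_union_Ioi (a := (0 : ℝ))]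
  exact hneg.union hpos

theorem pexp_normalizer_pos {p : ℝ} (hp : 1 ≤ p) :
    0 < 2 * Real.Gamma (1 / p) * p ^ (1 / p - 1) := by
  have hp0 : 0 < p := by linarith
  have := Real.Gamma_pos_of_pos (one_div_pos.2 hp0)
  positivity

theorem pexpDensity_nonneg {p : ℝ} (hp : 1 ≤ p) (x : ℝ) : 0 ≤ pexpDensity p x :=
  div_nonneg (Real.exp_pos _).le (pexp_normalizer_pos hp).le

theorem integrable_rpow_mul_pexpDensity {p s : ℝ} (hp : 1 ≤ p) (hs : -1 < s) :
    Integrable fun x => |x| ^ s * pexpDensity p x := by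
  have hp0 : 0 < p := by linarith
  have h := (integrable_comp_abs_of_integrableOn_Ioi
    (integrableOn_rpow_mul_exp_neg_mul_rpow hs hp0 (one_div_pos.2 hp0))).div_const
    (2 * Real.Gamma (1 / p) * p ^ (1 / p - 1))
  refine h.congr (ae_of_all _ fun x => ?_)
  simp only [pexpDensity]
  rw [mul_div_assoc]
  congr 3
  ring

theorem measurable_pexpDensity (p : ℝ) : Measurable (pexpDensity p) := by
  unfold pexpDensity
  fun_prop

theorem pexpMeasure_apply (p : ℝ) {s : Set ℝ} (hs : MeasurableSet s) :
    pexpMeasure p s = ∫⁻ x in s, ENNReal.ofReal (pexpDensity p x) :=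
  withDensity_apply _ hs

theorem isFiniteMeasure_pexpMeasure {p : ℝ} (hp : 1 ≤ p) : IsFiniteMeasure (pexpMeasure p) := by
  refine isFiniteMeasure_withDensity_ofReal ?_
  have h := integrable_rpow_mul_pexpDensity (s := 0) hp (by norm_num)
  simpa using h.hasFiniteIntegral

theorem pexpMeasure_secondMoment_lt_top {p : ℝ} (hp : 1 ≤ p) :
    ∫⁻ x, ENNReal.ofReal (x ^ 2) ∂(pexpMeasure p) < ⊤ := by
  unfold pexpMeasure
  rw [lintegral_withDensity_eq_lintegral_mul _ (measurable_pexpDensity p).ennreal_ofReal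
    (by fun_prop)]
  have h := (integrable_rpow_mul_pexpDensity (s := 2) hp (by norm_num)).lintegral_lt_top
  refine lt_of_le_of_lt (lintegral_mono fun x => ?_) h
  simp only [Pi.mul_apply]
  rw [← ENNReal.ofReal_mul (pexpDensity_nonneg hp x), mul_comm]
  simp

theorem exists_le_pexpMeasure_Icc {p : ℝ} (hp : 1 ≤ p) (hp2 : p ≤ 2) :
    ∃ κ : ℝ, 0 < κ ∧ κ ≤ 1 ∧ ∀ a t : ℝ, 0 ≤ t → t ≤ 1 →
      ENNReal.ofReal (κ * t * Real.exp (-2 * |a| ^ p)) ≤ pexpMeasure p (Icc (a - t) (a + t)) := by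
  have hp0 : 0 < p := by linarith
  set Z := 2 * Real.Gamma (1 / p) * p ^ (1 / p - 1) with hZ
  have hZ0 : 0 < Z := pexp_normalizer_pos hp
  refine ⟨min 1 (2 * Real.exp (-2) / Z), by positivity, min_le_left _ _, fun a t ht ht1 => ?_⟩
  rw [pexpMeasure_apply _ measurableSet_Icc]
  have hlow : ∀ x ∈ Icc (a - t) (a + t),
      Real.exp (-2) * Real.exp (-2 * |a| ^ p) / Z ≤ pexpDensity p x := by
    intro x hx
    unfold pexpDensity
    rw [← Real.exp_add]
    refine div_le_div_of_nonneg_right (Real.exp_le_exp.2 ?_) hZ0.le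
    have hxa : |x| ≤ 1 + |a| := by
      have : |x - a| ≤ t := abs_le.2 ⟨by linarith [hx.1], by linarith [hx.2]⟩
      have h2 := abs_add_le (x - a) a
      rw [sub_add_cancel] at h2
      linarith
    have h1 : |x| ^ p ≤ (1 + |a|) ^ p := Real.rpow_le_rpow (abs_nonneg _) hxa hp0.le
    have h2 : (1 + |a|) ^ p ≤ 2 ^ (p - 1) * (1 ^ p + |a| ^ p) := by
      have := NNReal.rpow_add_le_mul_rpow_add_rpow 1 ⟨|a|, abs_nonneg a⟩ hp
      exact_mod_cast this
    have h3 : (2 : ℝ) ^ (p - 1) ≤ 2 := by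
      calc (2 : ℝ) ^ (p - 1) ≤ 2 ^ (1 : ℝ) :=
            Real.rpow_le_rpow_of_exponent_le (by norm_num) (by linarith)
        _ = 2 := Real.rpow_one 2
    have ha0 : 0 ≤ |a| ^ p := Real.rpow_nonneg (abs_nonneg _) _
    rw [Real.one_rpow] at h2
    have h4 : |x| ^ p ≤ 2 * (1 + |a| ^ p) := h1.trans (h2.trans (by gcongr))
    have h5 : |x| ^ p / p ≤ |x| ^ p := div_le_self (Real.rpow_nonneg (abs_nonneg _) _) hp
    rw [neg_div]
    linarith
  calc ENNReal.ofReal (min 1 (2 * Real.exp (-2) / Z) * t * Real.exp (-2 * |a| ^ p))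
      ≤ ENNReal.ofReal (Real.exp (-2) * Real.exp (-2 * |a| ^ p) / Z * (2 * t)) := by
        refine ENNReal.ofReal_le_ofReal ?_
        calc min 1 (2 * Real.exp (-2) / Z) * t * Real.exp (-2 * |a| ^ p)
            ≤ (2 * Real.exp (-2) / Z) * t * Real.exp (-2 * |a| ^ p) := by
              gcongr
              exact min_le_right _ _
          _ = _ := by ring
    _ = ∫⁻ _x in Icc (a - t) (a + t),
          ENNReal.ofReal (Real.exp (-2) * Real.exp (-2 * |a| ^ p) / Z) := by
        rw [setLIntegral_const, Real.volume_Icc, ← ENNReal.ofReal_mul (by positivity)]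
        congr 2
        ring
    _ ≤ _ := setLIntegral_mono' measurableSet_Icc
        fun x hx => ENNReal.ofReal_le_ofReal (hlow x hx)

theorem isProbabilityMeasure_coordLaw {p α τ : ℝ} (hp : 1 ≤ p) {μ : Measure (ℕ → ℝ)}
    (hμ : IsPexpPrior p α τ μ) (i : ℕ) : IsProbabilityMeasure (coordLaw p α τ i) := by
  obtain ⟨hprob, hlim⟩ := hμ
  have := isFiniteMeasure_pexpMeasure hp
  have hfin : ∀ j, IsFiniteMeasure (coordLaw p α τ j) := fun j => by
    unfold coordLaw
    infer_instance
  have h : μ.map ({i} : Finset ℕ).restrict =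
      Measure.pi fun j : ({i} : Finset ℕ) => coordLaw p α τ j := hlim {i}
  have h1 : (Measure.pi fun j : ({i} : Finset ℕ) => coordLaw p α τ j) univ = 1 := by
    rw [← h, Measure.map_apply (Finset.measurable_restrict _) MeasurableSet.univ]
    simp
  rw [Measure.pi_univ] at h1
  exact ⟨by simpa using h1⟩

theorem eq_infinitePi_of_isPexpPrior {p α τ : ℝ} {μ : Measure (ℕ → ℝ)}
    (hμ : IsPexpPrior p α τ μ) [∀ i, IsProbabilityMeasure (coordLaw p α τ i)] :
    μ = Measure.infinitePi (coordLaw p α τ) :=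
  hμ.2.unique (Measure.isProjectiveLimit_infinitePi _)

theorem idx_pos (i : ℕ) : 0 < idx i := by
  unfold idx
  positivity

theorem one_le_idx (i : ℕ) : 1 ≤ idx i := by
  unfold idx
  linarith [Nat.cast_nonneg (α := ℝ) i]

theorem idx_le_of_lt {i N : ℕ} (h : i < N) : idx i ≤ N := by
  unfold idx
  exact_mod_cast h

theorem mul_rpow_neg_one_sub_le_sub {s a : ℝ} (hs : 0 ≤ s) (ha : 0 < a) :
    s * (a + 1) ^ (-1 - s) ≤ a ^ (-s) - (a + 1) ^ (-s) := by
  have ha1 : 0 < a + 1 := by linarith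
  have hr : 0 < a / (a + 1) := by positivity
  have h1 : a ^ (-s) = (a + 1) ^ (-s) * (a / (a + 1)) ^ (-s) := by
    rw [← Real.mul_rpow ha1.le hr.le]
    congr 1
    field_simp
  have h2 : 1 + s * (a + 1)⁻¹ ≤ (a / (a + 1)) ^ (-s) := by
    rw [Real.rpow_def_of_pos hr]
    have hlog : Real.log (a / (a + 1)) ≤ -(a + 1)⁻¹ := by
      have := Real.log_le_sub_one_of_pos hr
      have h3 : a / (a + 1) - 1 = -(a + 1)⁻¹ := by
        field_simp
        ring
      linarith
    have := Real.add_one_le_exp (Real.log (a / (a + 1)) * -s)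
    nlinarith
  have h3 : (a + 1) ^ (-1 - s) = (a + 1) ^ (-s) * (a + 1)⁻¹ := by
    rw [← Real.rpow_neg_one, ← Real.rpow_add ha1]
    congr 1
    ring
  have h4 : 0 < (a + 1) ^ (-s) := by positivity
  rw [h1, h3]
  nlinarith

theorem mul_rpow_sub_one_le_sub {u a : ℝ} (hu : 0 ≤ u) (hu1 : u ≤ 1) (ha : 0 ≤ a) :
    u * (a + 1) ^ (u - 1) ≤ (a + 1) ^ u - a ^ u := by
  have ha1 : 0 < a + 1 := by linarith
  have hinv : (a + 1)⁻¹ ≤ 1 := inv_le_one_of_one_le₀ (by linarith)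
  have h := rpow_one_add_le_one_add_mul_self (s := -(a + 1)⁻¹) (by linarith) hu hu1
  have h1 : a ^ u = (a + 1) ^ u * (1 + -(a + 1)⁻¹) ^ u := by
    rw [← Real.mul_rpow ha1.le (by linarith)]
    congr 1
    field_simp
    ring
  have h4 : 0 < (a + 1) ^ u := by positivity
  rw [h1, Real.rpow_sub_one ha1.ne', div_eq_mul_inv]
  nlinarith

theorem sum_idx_rpow_le_of_neg {s : ℝ} (hs : 0 < s) {J : ℕ} (hJ : 1 ≤ J) (n : ℕ) :
    ∑ i ∈ Finset.range n, (if i < J then 0 else idx i ^ (-1 - s)) ≤ (J : ℝ) ^ (-s) / s := by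
  have hJ0 : (0 : ℝ) < J := by exact_mod_cast hJ
  have key : ∀ n, ∑ i ∈ Finset.range n, (if i < J then 0 else idx i ^ (-1 - s)) ≤
      ((J : ℝ) ^ (-s) - ((max J n : ℕ) : ℝ) ^ (-s)) / s := by
    intro n
    induction n with
    | zero => simp
    | succ n ih =>
      rw [Finset.sum_range_succ]
      by_cases h : n < J
      · rw [max_eq_left (by omega : n ≤ J)] at ih
        rw [max_eq_left (by omega : n + 1 ≤ J)]
        simpa [h] using ih
      · rw [max_eq_right (by omega : J ≤ n)] at ih
        rw [max_eq_right (by omega : J ≤ n + 1)]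
        have hn : (0 : ℝ) < n := by exact_mod_cast (by omega : 0 < n)
        have := mul_rpow_neg_one_sub_le_sub hs.le hn
        rw [if_neg h, idx]
        rw [le_div_iff₀ hs] at ih ⊢
        push_cast
        linarith
  refine (key n).trans ?_
  gcongr
  have : (0 : ℝ) ≤ ((max J n : ℕ) : ℝ) ^ (-s) := by positivity
  linarith

theorem tsum_ofReal_idx_rpow_le {s : ℝ} (hs : 0 < s) {J : ℕ} (hJ : 1 ≤ J) :
    ∑' i, (if i < J then 0 else ENNReal.ofReal (idx i ^ (-1 - s))) ≤
      ENNReal.ofReal ((J : ℝ) ^ (-s) / s) := by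
  refine ENNReal.tsum_le_of_sum_range_le fun n => ?_
  refine le_trans (le_of_eq ?_) (ENNReal.ofReal_le_ofReal (sum_idx_rpow_le_of_neg hs hJ n))
  rw [ENNReal.ofReal_sum_of_nonneg]
  · refine Finset.sum_congr rfl fun i _ => ?_
    split_ifs <;> simp
  · intro i _
    have := idx_pos i
    split_ifs
    · exact le_rfl
    · positivity

theorem exists_sum_idx_rpow_le {t : ℝ} (ht : -1 < t) :
    ∃ c : ℝ, 0 < c ∧ ∀ N : ℕ, ∑ i ∈ Finset.range N, idx i ^ t ≤ c * (N : ℝ) ^ (t + 1) := by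
  have ht1 : 0 < t + 1 := by linarith
  rcases le_or_gt 0 t with h0 | h0
  · refine ⟨1, one_pos, fun N => ?_⟩
    calc ∑ i ∈ Finset.range N, idx i ^ t ≤ ∑ i ∈ Finset.range N, (N : ℝ) ^ t :=
          Finset.sum_le_sum fun i hi =>
            Real.rpow_le_rpow (idx_pos i).le (idx_le_of_lt (Finset.mem_range.1 hi)) h0
      _ = 1 * (N : ℝ) ^ (t + 1) := by
          rw [Real.rpow_add_one' (Nat.cast_nonneg N) ht1.ne']
          simp [mul_comm]
  · refine ⟨1 / (t + 1), by positivity, fun N => ?_⟩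
    induction N with
    | zero => simp [Real.zero_rpow ht1.ne']
    | succ n ih =>
      rw [Finset.sum_range_succ]
      have := mul_rpow_sub_one_le_sub ht1.le (by linarith) (Nat.cast_nonneg (α := ℝ) n)
      rw [add_sub_cancel_right] at this
      rw [one_div, inv_mul_eq_div, le_div_iff₀ ht1] at ih ⊢
      rw [idx]
      push_cast
      linarith

theorem exists_sum_idx_rpow_le_const {t : ℝ} (ht : t < -1) :
    ∃ c : ℝ, 0 < c ∧ ∀ N : ℕ, ∑ i ∈ Finset.range N, idx i ^ t ≤ c := by
  have hs : 0 < -1 - t := by linarith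
  refine ⟨1 + 1 / (-1 - t), by positivity, fun N => ?_⟩
  have h := sum_idx_rpow_le_of_neg hs le_rfl N
  rw [Nat.cast_one, Real.one_rpow, sub_sub_cancel] at h
  have h2 : ∀ n, ∑ i ∈ Finset.range n, idx i ^ t ≤
      1 + ∑ i ∈ Finset.range n, (if i < 1 then 0 else idx i ^ t) := by
    intro n
    induction n with
    | zero => simp
    | succ n ih =>
      rw [Finset.sum_range_succ, Finset.sum_range_succ]
      rcases Nat.eq_zero_or_pos n with rfl | hn
      · simp [idx]
      · rw [if_neg (by omega)]
        linarith
  linarith [h2 N]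

theorem sum_idx_rpow_neg_one_le (N : ℕ) :
    ∑ i ∈ Finset.range N, idx i ^ (-1 : ℝ) ≤ 1 + Real.log N := by
  have h := harmonic_le_one_add_log N
  refine le_trans (le_of_eq ?_) h
  simp [harmonic, idx, Real.rpow_neg_one]

theorem exp_neg_le_prod_idx_div {J : ℕ} (hJ : 1 ≤ J) :
    Real.exp (-(J : ℝ)) ≤ ∏ i ∈ Finset.range J, idx i / J := by
  have hJ0 : (0 : ℝ) < J := by exact_mod_cast hJ
  have h := Real.pow_div_factorial_le_exp (J : ℝ) hJ0.le J
  have h1 : ∏ i ∈ Finset.range J, idx i / J = (J.factorial : ℝ) / (J : ℝ) ^ J := by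
    rw [Finset.prod_div_distrib, Finset.prod_const, Finset.card_range, ← Finset.prod_range_add_one_eq_factorial]
    push_cast
    rfl
  rw [h1, Real.exp_neg, ← inv_div]
  have : (0 : ℝ) < J.factorial := by exact_mod_cast J.factorial_pos
  exact inv_anti₀ (by positivity) h

theorem l2norm_le_of_tsum_ofReal_le {x : ℕ → ℝ} {R : ℝ} (hR : 0 ≤ R)
    (h : ∑' i, ENNReal.ofReal (x i ^ 2) ≤ ENNReal.ofReal (R ^ 2)) : l2norm x ≤ R := by
  unfold l2norm
  by_cases hs : Summable fun i => x i ^ 2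
  · rw [← ENNReal.ofReal_tsum_of_nonneg (fun i => sq_nonneg _) hs,
      ENNReal.ofReal_le_ofReal_iff (sq_nonneg _)] at h
    exact Real.sqrt_le_iff.2 ⟨hR, h⟩
  · rw [tsum_eq_zero_of_not_summable hs, Real.sqrt_zero]
    exact hR

/-- The scale `τ ℓ^{−1/2−α}` of the coordinate `i`, with `ℓ = i + 1`. -/
def priorScale (α τ : ℝ) (i : ℕ) : ℝ := τ * idx i ^ (-(1 / 2 : ℝ) - α)

theorem priorScale_pos (α : ℝ) {τ : ℝ} (hτ : 0 < τ) (i : ℕ) : 0 < priorScale α τ i :=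
  mul_pos hτ (Real.rpow_pos_of_pos (idx_pos i) _)

theorem priorScale_sq (α τ : ℝ) (i : ℕ) :
    priorScale α τ i ^ 2 = τ ^ 2 * idx i ^ (-1 - 2 * α) := by
  rw [priorScale, mul_pow, ← Real.rpow_natCast (idx i ^ _), ← Real.rpow_mul (idx_pos i).le]
  congr 2
  push_cast
  ring

theorem coordLaw_Icc {p α τ : ℝ} (hτ : 0 < τ) (i : ℕ) (h r : ℝ) :
    coordLaw p α τ i (Icc (h - r) (h + r)) =
      pexpMeasure p (Icc (h / priorScale α τ i - r / priorScale α τ i)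
        (h / priorScale α τ i + r / priorScale α τ i)) := by
  have hσ := priorScale_pos α hτ i
  unfold coordLaw
  rw [Measure.map_apply (by fun_prop) measurableSet_Icc]
  congr 1
  ext x
  change _ ≤ priorScale α τ i * x ∧ priorScale α τ i * x ≤ _ ↔ _ ≤ x ∧ x ≤ _
  rw [← sub_div, ← add_div, div_le_iff₀ hσ, le_div_iff₀ hσ, mul_comm x]

theorem lintegral_coordLaw_sq_sub_le {p α τ : ℝ} [IsProbabilityMeasure (pexpMeasure p)]
    (hτ : 0 < τ) {m : ℝ} (hm : 0 ≤ m)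
    (hmom : ∫⁻ x, ENNReal.ofReal (x ^ 2) ∂(pexpMeasure p) ≤ ENNReal.ofReal m)
    (i : ℕ) {h : ℝ} (hh : |h / priorScale α τ i| ≤ 1) :
    ∫⁻ x, ENNReal.ofReal ((x - h) ^ 2) ∂(coordLaw p α τ i) ≤
      ENNReal.ofReal ((2 * m + 2) * priorScale α τ i ^ 2) := by
  have hσ := priorScale_pos α hτ i
  set σ := priorScale α τ i with hσd
  unfold coordLaw
  rw [lintegral_map (by fun_prop) (by fun_prop)]
  have hh2 : h ^ 2 ≤ σ ^ 2 := by
    rw [abs_div, abs_of_pos hσ, div_le_one hσ] at hh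
    rw [← sq_abs h]
    gcongr
  calc ∫⁻ x, ENNReal.ofReal ((τ * idx i ^ (-(1 / 2 : ℝ) - α) * x - h) ^ 2) ∂(pexpMeasure p)
      ≤ ∫⁻ x, (ENNReal.ofReal (2 * σ ^ 2) * ENNReal.ofReal (x ^ 2) +
          ENNReal.ofReal (2 * σ ^ 2)) ∂(pexpMeasure p) := by
        refine lintegral_mono fun x => ?_
        rw [← ENNReal.ofReal_mul (by positivity), ← ENNReal.ofReal_add (by positivity)
          (by positivity)]
        refine ENNReal.ofReal_le_ofReal ?_
        change (σ * x - h) ^ 2 ≤ _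
        nlinarith [sq_nonneg (σ * x + h)]
    _ = ENNReal.ofReal (2 * σ ^ 2) * ∫⁻ x, ENNReal.ofReal (x ^ 2) ∂(pexpMeasure p) +
          ENNReal.ofReal (2 * σ ^ 2) := by
        rw [lintegral_add_right _ measurable_const, lintegral_const_mul _ (by fun_prop)]
        simp
    _ ≤ ENNReal.ofReal (2 * σ ^ 2) * ENNReal.ofReal m + ENNReal.ofReal (2 * σ ^ 2) := by
        gcongr
    _ = _ := by
        rw [← ENNReal.ofReal_mul (by positivity), ← ENNReal.ofReal_add (by positivity)
          (by positivity)]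
        congr 1
        ring

theorem prod_idx_div_rpow_ge {κ δ : ℝ} (hκ : 0 < κ) (hδ : 0 ≤ δ) {J : ℕ} (hJ : 1 ≤ J) :
    Real.exp (-((-Real.log κ + δ) * J)) ≤ ∏ i ∈ Finset.range J, κ * (idx i / J) ^ δ := by
  have hnn : ∀ i ∈ Finset.range J, (0 : ℝ) ≤ idx i / J := fun i _ =>
    div_nonneg (idx_pos i).le (Nat.cast_nonneg J)
  rw [Finset.prod_mul_distrib, Finset.prod_const, Finset.card_range,
    Real.finsetProd_rpow _ _ hnn]
  have h1 := Real.rpow_le_rpow (Real.exp_pos _).le (exp_neg_le_prod_idx_div hJ) hδ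
  rw [← Real.exp_mul] at h1
  have h2 : κ ^ J = Real.exp (Real.log κ * J) := by
    rw [mul_comm, Real.exp_nat_mul, Real.exp_log hκ]
  rw [h2]
  calc Real.exp (-((-Real.log κ + δ) * J))
      = Real.exp (Real.log κ * J) * Real.exp (-(J : ℝ) * δ) := by
        rw [← Real.exp_add]
        congr 1
        ring
    _ ≤ _ := by gcongr

theorem tsum_ofReal_sq_sub_le {J N : ℕ} (hJ : 1 ≤ J) {F : Finset ℕ} {ρ : ℝ} (hρ : 0 < ρ)
    {θ θ₀ r : ℕ → ℝ} {s : ℕ → ℝ}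
    (hrJ : ∀ i, i < J → r i ^ 2 ≤ ρ / J)
    (hrs : ∀ i, J ≤ i → r i ^ 2 ≤ s i)
    (hs : ∑' i, (if i < J then 0 else ENNReal.ofReal (s i)) ≤ ENNReal.ofReal ρ)
    (hθF : ∀ i ∈ F, θ i ∈ Icc ((if i < N then θ₀ i else 0) - r i)
      ((if i < N then θ₀ i else 0) + r i))
    (hθ : ∑' i, (if i ∈ F then 0 else
      ENNReal.ofReal ((θ i - if i < N then θ₀ i else 0) ^ 2)) ≤ ENNReal.ofReal ρ)
    (hN : ∑' i, (if i < N then 0 else ENNReal.ofReal (θ₀ i ^ 2)) ≤ ENNReal.ofReal (3 * ρ)) :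
    ∑' i, ENNReal.ofReal ((θ i - θ₀ i) ^ 2) ≤ ENNReal.ofReal (12 * ρ) := by
  have hJ0 : (0 : ℝ) < J := by exact_mod_cast hJ
  have h1 : ∑' i, (if i < J then ENNReal.ofReal (ρ / J) else 0) = ENNReal.ofReal ρ := by
    rw [tsum_eq_sum (s := Finset.range J)]
    · rw [Finset.sum_congr rfl (g := fun _ => ENNReal.ofReal (ρ / J))
        (fun i hi => if_pos (Finset.mem_range.1 hi)), Finset.sum_const, Finset.card_range,
        nsmul_eq_mul, ← ENNReal.ofReal_natCast, ← ENNReal.ofReal_mul hJ0.le,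
        mul_div_cancel₀ _ hJ0.ne']
    · intro i hi
      exact if_neg fun h => hi (Finset.mem_range.2 h)
  have hpt : ∀ i, ENNReal.ofReal ((θ i - θ₀ i) ^ 2) ≤
      2 * (((if i ∈ F then 0 else
        ENNReal.ofReal ((θ i - if i < N then θ₀ i else 0) ^ 2)) +
        ((if i < J then ENNReal.ofReal (ρ / J) else 0) +
        (if i < J then 0 else ENNReal.ofReal (s i)))) +
        (if i < N then 0 else ENNReal.ofReal (θ₀ i ^ 2))) := by
    intro i
    have ha : ENNReal.ofReal ((θ i - θ₀ i) ^ 2) ≤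
        2 * (ENNReal.ofReal ((θ i - if i < N then θ₀ i else 0) ^ 2) +
          (if i < N then 0 else ENNReal.ofReal (θ₀ i ^ 2))) := by
      by_cases hi : i < N
      · simp only [hi, if_true, add_zero]
        exact le_mul_of_one_le_left zero_le one_le_two
      · simp only [hi, if_false, sub_zero]
        rw [← ENNReal.ofReal_add (sq_nonneg _) (sq_nonneg _),
          show (2 : ENNReal) = ENNReal.ofReal 2 by simp, ← ENNReal.ofReal_mul two_pos.le]
        refine ENNReal.ofReal_le_ofReal ?_
        nlinarith [sq_nonneg (θ i + θ₀ i)]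
    refine ha.trans ?_
    gcongr
    by_cases hi : i ∈ F
    · simp only [hi, if_true, zero_add]
      have hb : (θ i - if i < N then θ₀ i else 0) ^ 2 ≤ r i ^ 2 := by
        have := hθF i hi
        exact sq_le_sq' (by linarith [this.1]) (by linarith [this.2])
      by_cases hiJ : i < J
      · simp only [hiJ, if_true, add_zero]
        exact ENNReal.ofReal_le_ofReal (hb.trans (hrJ i hiJ))
      · simp only [hiJ, if_false, zero_add]
        exact ENNReal.ofReal_le_ofReal (hb.trans (hrs i (not_lt.1 hiJ)))
    · simp only [hi, if_false]
      exact le_self_add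
  refine (ENNReal.tsum_le_tsum hpt).trans ?_
  rw [ENNReal.tsum_mul_left, ENNReal.tsum_add, ENNReal.tsum_add, ENNReal.tsum_add, h1]
  calc _ ≤ 2 * ((ENNReal.ofReal ρ + (ENNReal.ofReal ρ + ENNReal.ofReal ρ)) +
        ENNReal.ofReal (3 * ρ)) := by gcongr
    _ = ENNReal.ofReal (12 * ρ) := by
      rw [← ENNReal.ofReal_add hρ.le hρ.le, ← ENNReal.ofReal_add hρ.le (by positivity),
        ← ENNReal.ofReal_add (by positivity) (by positivity),
        show (2 : ENNReal) = ENNReal.ofReal 2 by simp, ← ENNReal.ofReal_mul two_pos.le]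
      congr 1
      ring

theorem smallBall_ge {p α τ κ m ρ T : ℝ} (hp : 1 ≤ p) (hα : 0 < α) (hτ : 0 < τ)
    {μ : Measure (ℕ → ℝ)} (hμ : IsPexpPrior p α τ μ)
    (hκ0 : 0 < κ) (hκ1 : κ ≤ 1)
    (hκ : ∀ a t : ℝ, 0 ≤ t → t ≤ 1 →
      ENNReal.ofReal (κ * t * Real.exp (-2 * |a| ^ p)) ≤ pexpMeasure p (Icc (a - t) (a + t)))
    (hm : 0 ≤ m) (hmom : ∫⁻ x, ENNReal.ofReal (x ^ 2) ∂(pexpMeasure p) ≤ ENNReal.ofReal m)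
    (hρ : 0 < ρ) (hT : 0 ≤ T) (hTρ : 12 * ρ ≤ T ^ 2) {J : ℕ} (hJ : 1 ≤ J)
    (hJ1 : τ ^ 2 * (J : ℝ) ^ (-(2 * α)) ≤ ρ)
    (hJ2 : (2 * m + 2) * τ ^ 2 * ((J : ℝ) ^ (-(2 * α)) / (2 * α)) ≤ ρ / 2)
    {θ₀ : ℕ → ℝ} {N : ℕ}
    (hN : ∑' i, (if i < N then 0 else ENNReal.ofReal (θ₀ i ^ 2)) ≤ ENNReal.ofReal (3 * ρ)) :
    ENNReal.ofReal (Real.exp (-((2 - Real.log κ) *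
      ∑ i ∈ Finset.range N, |θ₀ i / priorScale α τ i| ^ p + (-Real.log κ + α + 3 / 2) * J))) ≤
      μ {θ | l2norm (fun i => θ i - θ₀ i) ≤ T} := by
  classical
  have hp0 : 0 < p := by linarith
  have hcoord := isProbabilityMeasure_coordLaw hp hμ
  have hpexp : IsProbabilityMeasure (pexpMeasure p) := by
    have h := (hcoord 0).measure_univ
    unfold coordLaw at h
    rw [Measure.map_apply (by fun_prop) MeasurableSet.univ, preimage_univ] at h
    exact ⟨h⟩
  have hJ0 : (0 : ℝ) < J := by exact_mod_cast hJ
  set σ := priorScale α τ with hσdef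
  have hσ : ∀ i, 0 < σ i := priorScale_pos α hτ
  set h : ℕ → ℝ := fun i => if i < N then θ₀ i else 0 with hh
  set a : ℕ → ℝ := fun i => h i / σ i with ha
  set rJ : ℝ := τ * (J : ℝ) ^ (-(1 / 2 : ℝ) - α) with hrJ
  have hrJ0 : 0 < rJ := by positivity
  set r : ℕ → ℝ := fun i => if i < J then rJ else σ i with hr
  have hr0 : ∀ i, 0 ≤ r i := fun i => by
    simp only [hr]
    split_ifs
    exacts [hrJ0.le, (hσ i).le]
  set F : Finset ℕ := Finset.range J ∪ (Finset.range N).filter fun i => 1 < |a i| with hF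
  have hFnot : ∀ i ∉ F, J ≤ i ∧ |a i| ≤ 1 := by
    intro i hi
    simp only [hF, Finset.mem_union, Finset.mem_range, Finset.mem_filter, not_or, not_and,
      not_lt] at hi
    refine ⟨hi.1, ?_⟩
    by_cases hiN : i < N
    · exact hi.2 hiN
    · simp [ha, hh, hiN]
  have htail : ∀ c : ℝ, 0 ≤ c → ∑' i, (if i < J then 0 else ENNReal.ofReal (c * σ i ^ 2)) ≤
      ENNReal.ofReal (c * τ ^ 2 * ((J : ℝ) ^ (-(2 * α)) / (2 * α))) := by
    intro c hc
    have hcc : 0 ≤ c * τ ^ 2 := by positivity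
    have : ∀ i, (if i < J then 0 else ENNReal.ofReal (c * σ i ^ 2)) =
        ENNReal.ofReal (c * τ ^ 2) *
          (if i < J then 0 else ENNReal.ofReal (idx i ^ (-1 - 2 * α))) := by
      intro i
      split_ifs
      · simp
      · rw [← ENNReal.ofReal_mul hcc, hσdef, priorScale_sq]
        ring_nf
    simp_rw [this]
    rw [ENNReal.tsum_mul_left, ENNReal.ofReal_mul hcc]
    gcongr
    exact tsum_ofReal_idx_rpow_le (by positivity) hJ
  have hsum : ∑' i, (if i ∈ F then 0 else
      ∫⁻ x, ENNReal.ofReal ((x - h i) ^ 2) ∂(coordLaw p α τ i)) ≤ ENNReal.ofReal ρ / 2 := by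
    calc ∑' i, (if i ∈ F then 0 else
          ∫⁻ x, ENNReal.ofReal ((x - h i) ^ 2) ∂(coordLaw p α τ i))
        ≤ ∑' i, (if i < J then 0 else ENNReal.ofReal ((2 * m + 2) * σ i ^ 2)) := by
          refine ENNReal.tsum_le_tsum fun i => ?_
          by_cases hi : i ∈ F
          · simp [hi]
          · have h2 := hFnot i hi
            rw [if_neg hi, if_neg (not_lt.2 h2.1)]
            exact lintegral_coordLaw_sq_sub_le hτ hm hmom i h2.2
      _ ≤ _ := htail _ (by positivity)
      _ ≤ ENNReal.ofReal (ρ / 2) := ENNReal.ofReal_le_ofReal hJ2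
      _ = ENNReal.ofReal ρ / 2 := by
          rw [ENNReal.ofReal_div_of_pos two_pos]
          simp
  have hmain := half_prod_le_infinitePi (coordLaw p α τ) F
    (A := fun i => Icc (h i - r i) (h i + r i)) (fun i => measurableSet_Icc)
    (g := fun i x => ENNReal.ofReal ((x - h i) ^ 2)) (fun i => by fun_prop)
    (ENNReal.ofReal_pos.2 hρ).ne' ENNReal.ofReal_ne_top hsum
  rw [← eq_infinitePi_of_isPexpPrior hμ] at hmain
  refine le_trans ?_ (hmain.trans (measure_mono ?_))
  · have hb : ∀ i ∈ F, ENNReal.ofReal (Real.exp (-((2 - Real.log κ) * |a i| ^ p)) *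
        (if i < J then κ * (idx i / J) ^ (1 / 2 + α) else 1)) ≤
        coordLaw p α τ i (Icc (h i - r i) (h i + r i)) := by
      intro i hi
      have hlog : Real.log κ ≤ 0 := Real.log_nonpos hκ0.le hκ1
      have hap : 0 ≤ |a i| ^ p := by positivity
      rw [coordLaw_Icc hτ]
      by_cases hiJ : i < J
      · have hratio : r i / σ i = (idx i / J) ^ (1 / 2 + α) := by
          simp only [hr, hiJ, if_true, hrJ, hσdef, priorScale]
          rw [mul_div_mul_left _ _ hτ.ne', ← Real.div_rpow hJ0.le (idx_pos i).le,
            show (-(1 / 2 : ℝ) - α) = -(1 / 2 + α) by ring, Real.rpow_neg (by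
              have := idx_pos i
              positivity), ← Real.inv_rpow (by
              have := idx_pos i
              positivity), inv_div]
        have hle1 : r i / σ i ≤ 1 := by
          rw [hratio]
          exact Real.rpow_le_one (div_nonneg (idx_pos i).le hJ0.le)
            ((div_le_one hJ0).2 (idx_le_of_lt hiJ)) (by positivity)
        refine le_trans (ENNReal.ofReal_le_ofReal ?_)
          (hκ (a i) (r i / σ i) (div_nonneg (hr0 i) (hσ i).le) hle1)
        rw [if_pos hiJ, hratio, mul_comm]
        have : 0 ≤ idx i / J := div_nonneg (idx_pos i).le hJ0.le
        gcongr
        nlinarith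
      · have hai : 1 < |a i| := by
          simp only [hF, Finset.mem_union, Finset.mem_range, hiJ, false_or,
            Finset.mem_filter] at hi
          exact hi.2
        have hap1 : 1 ≤ |a i| ^ p := Real.one_le_rpow hai.le hp0.le
        have hratio : r i / σ i = 1 := by
          simp only [hr, hiJ, if_false]
          exact div_self (hσ i).ne'
        have h1 := hκ (a i) 1 zero_le_one le_rfl
        rw [← hratio] at h1
        refine le_trans (ENNReal.ofReal_le_ofReal ?_) h1
        rw [if_neg hiJ, hratio, mul_one, mul_one]
        nth_rewrite 2 [← Real.exp_log hκ0]
        rw [← Real.exp_add]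
        refine Real.exp_le_exp.2 ?_
        nlinarith
    have hexpand : ∏ i ∈ F, (Real.exp (-((2 - Real.log κ) * |a i| ^ p)) *
        (if i < J then κ * (idx i / J) ^ (1 / 2 + α) else 1)) =
        Real.exp (-((2 - Real.log κ) * ∑ i ∈ F, |a i| ^ p)) *
          ∏ i ∈ Finset.range J, κ * (idx i / J) ^ (1 / 2 + α) := by
      rw [Finset.prod_mul_distrib, ← Real.exp_sum, Finset.sum_neg_distrib, ← Finset.mul_sum,
        ← Finset.prod_filter]
      congr 2
      ext i
      simp only [hF, Finset.mem_filter, Finset.mem_union, Finset.mem_range]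
      tauto
    have hsumF : ∑ i ∈ F, |a i| ^ p ≤
        ∑ i ∈ Finset.range N, |θ₀ i / σ i| ^ p := by
      have h0 : ∀ i, |a i| ^ p = if i < N then |θ₀ i / σ i| ^ p else 0 := by
        intro i
        by_cases hi : i < N
        · simp [ha, hh, hi]
        · simp [ha, hh, hi, Real.zero_rpow hp0.ne']
      simp_rw [h0]
      rw [← Finset.sum_filter]
      refine Finset.sum_le_sum_of_subset_of_nonneg ?_ fun i _ _ => by positivity
      intro i hi
      exact Finset.mem_range.2 (Finset.mem_filter.1 hi).2
    have hprod := prod_idx_div_rpow_ge (δ := 1 / 2 + α) hκ0 (by positivity) hJ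
    have hlogκ : 0 ≤ 2 - Real.log κ := by linarith [Real.log_nonpos hκ0.le hκ1]
    have hhalf : Real.exp (-(J : ℝ)) ≤ 1 / 2 := by
      have h1 : (1 : ℝ) ≤ J := by exact_mod_cast hJ
      have h2 : (2 : ℝ) ≤ Real.exp J := by linarith [Real.add_one_le_exp (J : ℝ)]
      rw [Real.exp_neg, one_div]
      exact inv_anti₀ two_pos h2
    calc ENNReal.ofReal (Real.exp (-((2 - Real.log κ) *
          ∑ i ∈ Finset.range N, |θ₀ i / σ i| ^ p + (-Real.log κ + α + 3 / 2) * J)))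
        ≤ ENNReal.ofReal ((∏ i ∈ F, (Real.exp (-((2 - Real.log κ) * |a i| ^ p)) *
            (if i < J then κ * (idx i / J) ^ (1 / 2 + α) else 1))) / 2) := by
          refine ENNReal.ofReal_le_ofReal ?_
          rw [hexpand]
          calc Real.exp (-((2 - Real.log κ) *
              ∑ i ∈ Finset.range N, |θ₀ i / σ i| ^ p + (-Real.log κ + α + 3 / 2) * J))
              = Real.exp (-((2 - Real.log κ) * ∑ i ∈ Finset.range N, |θ₀ i / σ i| ^ p)) *
                Real.exp (-((-Real.log κ + (1 / 2 + α)) * J)) * Real.exp (-(J : ℝ)) := by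
                rw [← Real.exp_add, ← Real.exp_add]
                congr 1
                ring
            _ ≤ Real.exp (-((2 - Real.log κ) * ∑ i ∈ F, |a i| ^ p)) *
                (∏ i ∈ Finset.range J, κ * (idx i / J) ^ (1 / 2 + α)) * (1 / 2) := by
                gcongr
                exact mul_nonneg (Real.exp_pos _).le ((Real.exp_pos _).le.trans hprod)
            _ = _ := by ring
      _ = (∏ i ∈ F, ENNReal.ofReal (Real.exp (-((2 - Real.log κ) * |a i| ^ p)) *
            (if i < J then κ * (idx i / J) ^ (1 / 2 + α) else 1))) / 2 := by
          rw [ENNReal.ofReal_div_of_pos two_pos, ENNReal.ofReal_prod_of_nonneg]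
          · simp
          · intro i _
            have : 0 ≤ idx i / J := div_nonneg (idx_pos i).le hJ0.le
            split_ifs <;> positivity
      _ ≤ _ := by
          gcongr with i hi
          exact hb i hi
  · rintro θ ⟨hθF, hθ⟩
    refine l2norm_le_of_tsum_ofReal_le hT
      (le_trans ?_ (ENNReal.ofReal_le_ofReal hTρ))
    refine tsum_ofReal_sq_sub_le hJ hρ (r := r) (s := fun i => 1 * σ i ^ 2) ?_ ?_ ?_ hθF hθ hN
    · intro i hi
      simp only [hr, hi, if_true, hrJ]
      rw [mul_pow, ← Real.rpow_natCast ((J : ℝ) ^ _), ← Real.rpow_mul hJ0.le,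
        show (-(1 / 2 : ℝ) - α) * (2 : ℕ) = -(2 * α) - 1 by push_cast; ring,
        Real.rpow_sub_one hJ0.ne', ← mul_div_assoc]
      gcongr
    · intro i hi
      simp [hr, not_lt.2 hi]
    · refine (htail 1 zero_le_one).trans (ENNReal.ofReal_le_ofReal ?_)
      have : 0 ≤ τ ^ 2 * ((J : ℝ) ^ (-(2 * α)) / (2 * α)) := by positivity
      nlinarith

theorem exists_smallBall_bound {p α K Ctil : ℝ} (hp : 1 ≤ p) (hp2 : p ≤ 2) (hα : 0 < α)
    (hK : 0 < K) (hC : 0 < Ctil) :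
    ∃ B : ℝ, 0 < B ∧ ∀ τ e : ℝ, 0 < τ → 0 < e → e ≤ Ctil * τ →
      ∀ μ : Measure (ℕ → ℝ), IsPexpPrior p α τ μ → ∀ (θ₀ : ℕ → ℝ) (N : ℕ),
        ∑' i, (if i < N then 0 else ENNReal.ofReal (θ₀ i ^ 2)) ≤
          ENNReal.ofReal ((K * e / 2) ^ 2) →
        ENNReal.ofReal (Real.exp (-(B * ∑ i ∈ Finset.range N, |θ₀ i / priorScale α τ i| ^ p +
          B * (τ / e) ^ (1 / α)))) ≤
          μ {θ | l2norm (fun i => θ i - θ₀ i) ≤ K * e} := by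
  obtain ⟨κ, hκ0, hκ1, hκ⟩ := exists_le_pexpMeasure_Icc hp hp2
  set m := (∫⁻ x, ENNReal.ofReal (x ^ 2) ∂(pexpMeasure p)).toReal with hm
  have hmom : ∫⁻ x, ENNReal.ofReal (x ^ 2) ∂(pexpMeasure p) ≤ ENNReal.ofReal m :=
    (ENNReal.ofReal_toReal (pexpMeasure_secondMoment_lt_top hp).ne).ge
  have hm0 : 0 ≤ m := ENNReal.toReal_nonneg
  have hlog : Real.log κ ≤ 0 := Real.log_nonpos hκ0.le hκ1
  set D : ℝ := (12 + 24 * (2 * m + 2) / (2 * α)) / K ^ 2 with hD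
  have hD0 : 0 < D := by positivity
  set C₁ : ℝ := D ^ (1 / (2 * α)) with hC₁
  have hC₁0 : 0 < C₁ := by positivity
  set c₂ : ℝ := (-Real.log κ + α + 3 / 2) * (C₁ + Ctil ^ (1 / α)) with hc₂
  have hc₂0 : 0 < c₂ := by
    have : 0 < -Real.log κ + α + 3 / 2 := by linarith
    positivity
  refine ⟨2 - Real.log κ + c₂, by linarith, fun τ e hτ he heC μ hμ θ₀ N hN => ?_⟩
  set x : ℝ := (τ / e) ^ (1 / α) with hx
  have hx0 : 0 < x := by positivity
  have hxC : 1 ≤ Ctil ^ (1 / α) * x := by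
    rw [hx, ← Real.mul_rpow hC.le (by positivity)]
    refine Real.one_le_rpow ?_ (by positivity)
    rw [← mul_div_assoc, one_le_div he]
    exact heC
  set J : ℕ := ⌈C₁ * x⌉₊ with hJ
  have hJ1 : 1 ≤ J := Nat.one_le_ceil_iff.2 (by positivity)
  have hJle : (J : ℝ) ≤ (C₁ + Ctil ^ (1 / α)) * x := by
    have := (Nat.ceil_lt_add_one (by positivity : 0 ≤ C₁ * x)).le
    linarith
  have hJge : C₁ * x ≤ J := Nat.le_ceil _
  have hpow : D * (τ ^ 2 * (J : ℝ) ^ (-(2 * α))) ≤ e ^ 2 := by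
    have h1 : (J : ℝ) ^ (-(2 * α)) ≤ (C₁ * x) ^ (-(2 * α)) :=
      Real.rpow_le_rpow_of_nonpos (by positivity) hJge (by linarith)
    have h2 : (C₁ * x) ^ (-(2 * α)) = D⁻¹ * ((τ / e) ^ 2)⁻¹ := by
      rw [Real.mul_rpow hC₁0.le hx0.le, hC₁, hx, ← Real.rpow_mul hD0.le,
        ← Real.rpow_mul (by positivity),
        show 1 / (2 * α) * -(2 * α) = -1 by field_simp,
        show 1 / α * -(2 * α) = -2 by field_simp, Real.rpow_neg_one,
        Real.rpow_neg (by positivity)]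
      norm_num
    calc D * (τ ^ 2 * (J : ℝ) ^ (-(2 * α))) ≤ D * (τ ^ 2 * (D⁻¹ * ((τ / e) ^ 2)⁻¹)) := by
          rw [← h2]
          gcongr
      _ = e ^ 2 := by field_simp
  have hexpand : D * (τ ^ 2 * (J : ℝ) ^ (-(2 * α))) * K ^ 2 =
      12 * (τ ^ 2 * (J : ℝ) ^ (-(2 * α))) +
        24 * ((2 * m + 2) * τ ^ 2 * ((J : ℝ) ^ (-(2 * α)) / (2 * α))) := by
    rw [hD]
    field_simp
  have hKe : D * (τ ^ 2 * (J : ℝ) ^ (-(2 * α))) * K ^ 2 ≤ K ^ 2 * e ^ 2 := by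
    nlinarith [sq_nonneg K]
  have hs0 : 0 ≤ τ ^ 2 * (J : ℝ) ^ (-(2 * α)) := by positivity
  have hs1 : 0 ≤ (2 * m + 2) * τ ^ 2 * ((J : ℝ) ^ (-(2 * α)) / (2 * α)) := by positivity
  have key := smallBall_ge (ρ := (K * e) ^ 2 / 12) (T := K * e) hp hα hτ hμ hκ0 hκ1 hκ hm0 hmom
    (by positivity) (by positivity) (by linarith) hJ1 (by rw [mul_pow]; linarith)
    (by rw [mul_pow]; linarith) (θ₀ := θ₀) (N := N)
    (hN.trans (ENNReal.ofReal_le_ofReal (le_of_eq (by ring))))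
  refine le_trans (ENNReal.ofReal_le_ofReal (Real.exp_le_exp.2 (neg_le_neg ?_))) key
  have hS : 0 ≤ ∑ i ∈ Finset.range N, |θ₀ i / priorScale α τ i| ^ p :=
    Finset.sum_nonneg fun i _ => by positivity
  have h3 : (-Real.log κ + α + 3 / 2) * J ≤ c₂ * x := by
    rw [hc₂, mul_assoc]
    exact mul_le_mul_of_nonneg_left hJle (by linarith)
  nlinarith

/-- The terms `ℓ^{qβ+q/2−1}|θ_ℓ|^q` of the `q`-th power of the Besov norm. -/
def besovTerm (β q : ℝ) (θ : ℕ → ℝ) (i : ℕ) : ℝ := idx i ^ (q * β + q / 2 - 1) * |θ i| ^ q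

theorem besovTerm_nonneg (β q : ℝ) (θ : ℕ → ℝ) (i : ℕ) : 0 ≤ besovTerm β q θ i :=
  mul_nonneg (Real.rpow_nonneg (idx_pos i).le _) (Real.rpow_nonneg (abs_nonneg _) _)

theorem sum_besovTerm_le {β q L : ℝ} (hq : 0 < q) {θ : ℕ → ℝ}
    (hθ : inBesovBall β q L θ) (s : Finset ℕ) : ∑ i ∈ s, besovTerm β q θ i ≤ L ^ q := by
  obtain ⟨hs, hn⟩ := hθ
  have h0 : 0 ≤ ∑' i, besovTerm β q θ i := tsum_nonneg (besovTerm_nonneg β q θ)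
  have h1 : ∑ i ∈ s, besovTerm β q θ i ≤ ∑' i, besovTerm β q θ i :=
    hs.sum_le_tsum s fun i _ => besovTerm_nonneg β q θ i
  refine h1.trans ?_
  have h2 := Real.rpow_le_rpow (Real.rpow_nonneg h0 _) hn hq.le
  rwa [← Real.rpow_mul h0, one_div_mul_cancel hq.ne', Real.rpow_one] at h2

theorem abs_rpow_eq_besovTerm {β q : ℝ} (hq : 0 < q) (θ : ℕ → ℝ) (p : ℝ) (i : ℕ) :
    |θ i| ^ p = besovTerm β q θ i ^ (p / q) * idx i ^ (-(p * (β + 1 / 2 - 1 / q))) := by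
  have hi := idx_pos i
  rw [besovTerm, Real.mul_rpow (by positivity) (by positivity), ← Real.rpow_mul hi.le,
    ← Real.rpow_mul (abs_nonneg _), mul_div_cancel₀ _ hq.ne', mul_right_comm,
    ← Real.rpow_add hi]
  have : (q * β + q / 2 - 1) * (p / q) + -(p * (β + 1 / 2 - 1 / q)) = 0 := by
    field_simp
    ring
  rw [this, Real.rpow_zero, one_mul]

theorem besov_tail_le {β q L : ℝ} (hq : 0 < q) (hq2 : q ≤ 2) (hs : 0 ≤ β + 1 / 2 - 1 / q)
    (hL : 0 < L) {θ : ℕ → ℝ} (hθ : inBesovBall β q L θ) (N : ℕ) :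
    ∑' i, (if i < N then 0 else ENNReal.ofReal (θ i ^ 2)) ≤
      ENNReal.ofReal ((L * ((N : ℝ) + 1) ^ (-(β + 1 / 2 - 1 / q))) ^ 2) := by
  set s := β + 1 / 2 - 1 / q with hsd
  have hN1 : (0 : ℝ) < (N : ℝ) + 1 := by positivity
  have hterm : ∀ i, (if i < N then 0 else θ i ^ 2) ≤
      besovTerm β q θ i * (L ^ (2 - q) * ((N : ℝ) + 1) ^ (-(2 * s))) := by
    intro i
    have hb := besovTerm_nonneg β q θ i
    split_ifs with hi
    · positivity
    · have h1 : θ i ^ 2 = besovTerm β q θ i ^ (2 / q) * idx i ^ (-(2 * s)) := by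
        rw [← abs_rpow_eq_besovTerm hq θ 2 i]
        norm_num
      have h2 : idx i ^ (-(2 * s)) ≤ ((N : ℝ) + 1) ^ (-(2 * s)) := by
        refine Real.rpow_le_rpow_of_nonpos hN1 ?_ (by linarith)
        unfold idx
        have : (N : ℝ) ≤ i := by exact_mod_cast not_lt.1 hi
        linarith
      have hq1 : 0 ≤ 2 / q - 1 := by
        rw [sub_nonneg, one_le_div hq]
        exact hq2
      have h3 : besovTerm β q θ i ^ (2 / q) ≤ besovTerm β q θ i * L ^ (2 - q) := by
        have hbL : besovTerm β q θ i ≤ L ^ q := by simpa using sum_besovTerm_le hq hθ {i}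
        have h4 : besovTerm β q θ i ^ (2 / q) =
            besovTerm β q θ i * besovTerm β q θ i ^ (2 / q - 1) := by
          conv_lhs => rw [show 2 / q = 1 + (2 / q - 1) by ring]
          rw [Real.rpow_add_of_nonneg hb zero_le_one hq1, Real.rpow_one]
        have h5 : L ^ (2 - q) = (L ^ q) ^ (2 / q - 1) := by
          rw [← Real.rpow_mul hL.le]
          congr 1
          field_simp
        rw [h4, h5]
        gcongr
      rw [h1, ← mul_assoc]
      have := (idx_pos i).le
      gcongr
  refine ENNReal.tsum_le_of_sum_range_le fun n => ?_
  have heq : ∑ i ∈ Finset.range n, (if i < N then 0 else ENNReal.ofReal (θ i ^ 2)) =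
      ENNReal.ofReal (∑ i ∈ Finset.range n, (if i < N then 0 else θ i ^ 2)) := by
    rw [ENNReal.ofReal_sum_of_nonneg]
    · refine Finset.sum_congr rfl fun i _ => ?_
      split_ifs <;> simp
    · intro i _
      split_ifs <;> positivity
  rw [heq]
  refine ENNReal.ofReal_le_ofReal ((Finset.sum_le_sum fun i _ => hterm i).trans ?_)
  rw [← Finset.sum_mul]
  have hLL : L ^ q * L ^ (2 - q) = L ^ 2 := by
    rw [← Real.rpow_add hL, add_sub_cancel, Real.rpow_two]
  have hNN : ((N : ℝ) + 1) ^ (-(2 * s)) = (((N : ℝ) + 1) ^ (-s)) ^ 2 := by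
    rw [← Real.rpow_natCast, ← Real.rpow_mul hN1.le]
    congr 1
    push_cast
    ring
  calc _ ≤ L ^ q * (L ^ (2 - q) * ((N : ℝ) + 1) ^ (-(2 * s))) := by
        gcongr
        exact sum_besovTerm_le hq hθ _
    _ = _ := by
        rw [← mul_assoc, hLL, hNN, mul_pow]

theorem sum_rpow_mul_idx_rpow_le {γ r M : ℝ} (hγ : 0 < γ) (hγ1 : γ < 1) {b : ℕ → ℝ}
    (hb : ∀ i, 0 ≤ b i) (N : ℕ) (hM : ∑ i ∈ Finset.range N, b i ≤ M) :
    ∑ i ∈ Finset.range N, b i ^ (1 - γ) * idx i ^ (r - γ) ≤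
      M ^ (1 - γ) * (∑ i ∈ Finset.range N, idx i ^ (r / γ - 1)) ^ γ := by
  have h1γ : 0 < 1 - γ := by linarith
  have hconj : Real.HolderConjugate (1 / (1 - γ)) (1 / γ) := by
    rw [Real.holderConjugate_iff]
    refine ⟨by rw [lt_div_iff₀ h1γ]; linarith, by simp⟩
  have h := Real.inner_le_Lp_mul_Lq_of_nonneg (Finset.range N) hconj
    (f := fun i => b i ^ (1 - γ)) (g := fun i => idx i ^ (r - γ))
    (fun i _ => Real.rpow_nonneg (hb i) _) (fun i _ => Real.rpow_nonneg (idx_pos i).le _)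
  have e1 : ∀ i, (b i ^ (1 - γ)) ^ (1 / (1 - γ)) = b i := fun i => by
    rw [← Real.rpow_mul (hb i), mul_one_div_cancel h1γ.ne', Real.rpow_one]
  have e2 : ∀ i, (idx i ^ (r - γ)) ^ (1 / γ) = idx i ^ (r / γ - 1) := fun i => by
    rw [← Real.rpow_mul (idx_pos i).le]
    congr 1
    field_simp
  simp only [e1, e2, one_div_one_div] at h
  refine h.trans ?_
  have h0 : 0 ≤ ∑ i ∈ Finset.range N, b i := Finset.sum_nonneg fun i _ => hb i
  have h2 : 0 ≤ ∑ i ∈ Finset.range N, idx i ^ (r / γ - 1) :=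
    Finset.sum_nonneg fun i _ => Real.rpow_nonneg (idx_pos i).le _
  gcongr

theorem exists_weighted_sum_le_of_pos {γ r M : ℝ} (hγ : 0 ≤ γ) (hγ1 : γ < 1) (hM0 : 0 < M)
    (hr : 0 < r) :
    ∃ c : ℝ, 0 < c ∧ ∀ (b : ℕ → ℝ), (∀ i, 0 ≤ b i) → ∀ N : ℕ,
      ∑ i ∈ Finset.range N, b i ≤ M →
      ∑ i ∈ Finset.range N, b i ^ (1 - γ) * idx i ^ (r - γ) ≤ c * (N : ℝ) ^ r := by
  rcases hγ.eq_or_lt with rfl | hγ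
  · refine ⟨M, hM0, fun b hb N hM => ?_⟩
    simp only [sub_zero, Real.rpow_one]
    calc ∑ i ∈ Finset.range N, b i * idx i ^ r
        ≤ ∑ i ∈ Finset.range N, b i * (N : ℝ) ^ r := by
          refine Finset.sum_le_sum fun i hi => mul_le_mul_of_nonneg_left ?_ (hb i)
          exact Real.rpow_le_rpow (idx_pos i).le (idx_le_of_lt (Finset.mem_range.1 hi)) hr.le
      _ = (∑ i ∈ Finset.range N, b i) * (N : ℝ) ^ r := by rw [Finset.sum_mul]
      _ ≤ M * (N : ℝ) ^ r := by gcongr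
  · obtain ⟨c, hc, hcN⟩ := exists_sum_idx_rpow_le (t := r / γ - 1) (by
      have : 0 < r / γ := by positivity
      linarith)
    refine ⟨M ^ (1 - γ) * c ^ γ, by positivity, fun b hb N hM => ?_⟩
    refine (sum_rpow_mul_idx_rpow_le hγ hγ1 hb N hM).trans ?_
    rw [mul_assoc]
    have h1 : c ^ γ * (N : ℝ) ^ r = (c * (N : ℝ) ^ (r / γ - 1 + 1)) ^ γ := by
      rw [Real.mul_rpow hc.le (by positivity), ← Real.rpow_mul (Nat.cast_nonneg N),
        sub_add_cancel, div_mul_cancel₀ _ hγ.ne']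
    rw [h1]
    have h2 : 0 ≤ ∑ i ∈ Finset.range N, idx i ^ (r / γ - 1) :=
      Finset.sum_nonneg fun i _ => Real.rpow_nonneg (idx_pos i).le _
    gcongr
    exact hcN N

theorem exists_weighted_sum_le_of_neg {γ r M : ℝ} (hγ : 0 ≤ γ) (hγ1 : γ < 1) (hM0 : 0 < M)
    (hr : r < 0) :
    ∃ c : ℝ, 0 < c ∧ ∀ (b : ℕ → ℝ), (∀ i, 0 ≤ b i) → ∀ N : ℕ,
      ∑ i ∈ Finset.range N, b i ≤ M →
      ∑ i ∈ Finset.range N, b i ^ (1 - γ) * idx i ^ (r - γ) ≤ c := by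
  rcases hγ.eq_or_lt with rfl | hγ
  · refine ⟨M, hM0, fun b hb N hM => ?_⟩
    simp only [sub_zero, Real.rpow_one]
    refine le_trans (Finset.sum_le_sum fun i _ => ?_) hM
    exact mul_le_of_le_one_right (hb i) (Real.rpow_le_one_of_one_le_of_nonpos (one_le_idx i) hr.le)
  · obtain ⟨c, hc, hcN⟩ := exists_sum_idx_rpow_le_const (t := r / γ - 1) (by
      have : r / γ < 0 := div_neg_of_neg_of_pos hr hγ
      linarith)
    refine ⟨M ^ (1 - γ) * c ^ γ, by positivity, fun b hb N hM => ?_⟩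
    refine (sum_rpow_mul_idx_rpow_le hγ hγ1 hb N hM).trans ?_
    have h2 : 0 ≤ ∑ i ∈ Finset.range N, idx i ^ (r / γ - 1) :=
      Finset.sum_nonneg fun i _ => Real.rpow_nonneg (idx_pos i).le _
    gcongr
    exact hcN N

theorem weighted_sum_le_log {γ M : ℝ} (hγ : 0 ≤ γ) (hγ1 : γ < 1) (hM0 : 0 < M)
    {b : ℕ → ℝ} (hb : ∀ i, 0 ≤ b i) (N : ℕ) (hM : ∑ i ∈ Finset.range N, b i ≤ M) :
    ∑ i ∈ Finset.range N, b i ^ (1 - γ) * idx i ^ (-γ) ≤ M ^ (1 - γ) * (1 + Real.log N) ^ γ := by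
  rcases hγ.eq_or_lt with rfl | hγ
  · simpa using hM
  · have h := sum_rpow_mul_idx_rpow_le (r := 0) hγ hγ1 hb N hM
    simp only [zero_sub, zero_div] at h
    refine h.trans ?_
    have h2 : 0 ≤ ∑ i ∈ Finset.range N, idx i ^ (-1 : ℝ) :=
      Finset.sum_nonneg fun i _ => Real.rpow_nonneg (idx_pos i).le _
    gcongr
    exact sum_idx_rpow_neg_one_le N

theorem abs_div_priorScale_rpow {p q α β τ : ℝ} (hq : 0 < q) (hτ : 0 < τ) (θ : ℕ → ℝ) (i : ℕ) :
    |θ i / priorScale α τ i| ^ p = τ ^ (-p) * (besovTerm β q θ i ^ (1 - (q - p) / q) *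
      idx i ^ (1 + p * (α - β) - (q - p) / q)) := by
  have hi := idx_pos i
  have hσ := priorScale_pos α hτ i
  rw [abs_div, abs_of_pos hσ, Real.div_rpow (abs_nonneg _) hσ.le,
    abs_rpow_eq_besovTerm (β := β) hq θ p i, priorScale,
    Real.mul_rpow hτ.le (by positivity), ← Real.rpow_mul hi.le, Real.rpow_neg hτ.le,
    show 1 - (q - p) / q = p / q by field_simp; ring]
  have h1 : idx i ^ (1 + p * (α - β) - (q - p) / q) =
      idx i ^ (-(p * (β + 1 / 2 - 1 / q))) / idx i ^ ((-(1 / 2 : ℝ) - α) * p) := by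
    rw [← Real.rpow_sub hi]
    congr 1
    field_simp
    ring
  rw [h1]
  field_simp

theorem le_of_rpow_le_mul {e k c y : ℝ} (he : 0 < e) (hk : 0 < k) (hc : 0 ≤ c) (hy : 0 ≤ y)
    (h : e ^ k ≤ c * y) : e ≤ c ^ (1 / k) * y ^ (1 / k) := by
  rw [← Real.mul_rpow hc hy]
  have := Real.rpow_le_rpow (by positivity) h (one_div_pos.2 hk).le
  rwa [← Real.rpow_mul he.le, mul_one_div_cancel hk.ne', Real.rpow_one] at this

theorem le_of_mul_sq_le_mul_div_rpow {α τ e m c : ℝ} (hα : 0 < α) (hτ : 0 < τ) (he : 0 < e)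
    (hm : 0 < m) (hc : 0 ≤ c) (h : m * e ^ 2 ≤ c * (τ / e) ^ (1 / α)) :
    e ≤ c ^ (α / (1 + 2 * α)) * (m ^ (-(α / (1 + 2 * α))) * τ ^ (1 / (1 + 2 * α))) := by
  have hk : 0 < 2 + 1 / α := by positivity
  have hk' : 1 / (2 + 1 / α) = α / (1 + 2 * α) := by
    field_simp
    ring
  have h1 : e ^ (2 + 1 / α) ≤ c * (m⁻¹ * τ ^ (1 / α)) := by
    rw [Real.rpow_add he, Real.rpow_two]
    rw [Real.div_rpow hτ.le he.le, ← mul_div_assoc, le_div_iff₀ (by positivity)] at h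
    calc e ^ 2 * e ^ (1 / α) = m⁻¹ * (m * e ^ 2 * e ^ (1 / α)) := by field_simp
      _ ≤ m⁻¹ * (c * τ ^ (1 / α)) := by gcongr
      _ = _ := by ring
  have h2 := le_of_rpow_le_mul he hk hc (by positivity) h1
  rw [hk', Real.mul_rpow (by positivity) (by positivity), ← Real.rpow_mul hτ.le,
    Real.inv_rpow hm.le, ← Real.rpow_neg hm.le] at h2
  have h3 : 1 / α * (α / (1 + 2 * α)) = 1 / (1 + 2 * α) := by field_simp
  rwa [h3] at h2

theorem le_of_smallBall_eq {p q α β K Ctil L : ℝ} (hp : 1 ≤ p) (hpq : p ≤ q) (hq : q < 2)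
    (hα : 0 < α) (hs : 0 < β + 1 / 2 - 1 / q) (hK : 0 < K) (hC : 0 < Ctil) (hL : 0 < L) :
    ∃ B : ℝ, 0 < B ∧ ∀ τ e m : ℝ, 0 < τ → 0 < e → 0 < m → e ≤ Ctil * τ →
      ∀ μ, IsPexpPrior p α τ μ → ∀ θ₀ : ℕ → ℝ, inBesovBall β q L θ₀ →
      μ {θ | l2norm (fun i => θ i - θ₀ i) ≤ K * e} = ENNReal.ofReal (Real.exp (-m * e ^ 2)) →
      e ≤ B * (m ^ (-(α / (1 + 2 * α))) * τ ^ (1 / (1 + 2 * α))) ∨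
      ∃ N : ℕ, (N : ℝ) ≤ (2 * L / (K * e)) ^ (1 / (β + 1 / 2 - 1 / q)) ∧
        e ^ 2 ≤ B * (m * τ ^ p)⁻¹ * ∑ i ∈ Finset.range N,
          besovTerm β q θ₀ i ^ (1 - (q - p) / q) *
            idx i ^ (1 + p * (α - β) - (q - p) / q) := by
  obtain ⟨B, hB, hmain⟩ := exists_smallBall_bound (K := K) hp (hpq.trans hq.le) hα hK hC
  have hq0 : 0 < q := by linarith
  set s := β + 1 / 2 - 1 / q with hsd
  refine ⟨max (2 * B) ((2 * B) ^ (α / (1 + 2 * α))), by positivity, ?_⟩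
  intro τ e m hτ he hm heC μ hμ θ₀ hθ hmass
  set y := 2 * L / (K * e) with hy
  have hy0 : 0 < y := by positivity
  set N := ⌊y ^ (1 / s)⌋₊ with hN
  have hN1 : (N : ℝ) ≤ y ^ (1 / s) := Nat.floor_le (by positivity)
  have hN2 : y ^ (1 / s) ≤ (N : ℝ) + 1 := (Nat.lt_floor_add_one _).le
  have hN3 : L * ((N : ℝ) + 1) ^ (-s) ≤ K * e / 2 := by
    have h1 : ((N : ℝ) + 1) ^ (-s) ≤ (y ^ (1 / s)) ^ (-s) :=
      Real.rpow_le_rpow_of_nonpos (by positivity) hN2 (by linarith)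
    rw [← Real.rpow_mul hy0.le, show 1 / s * -s = -1 by field_simp, Real.rpow_neg_one] at h1
    calc L * ((N : ℝ) + 1) ^ (-s) ≤ L * y⁻¹ := by gcongr
      _ = K * e / 2 := by rw [hy]; field_simp
  have htail := (besov_tail_le hq0 hq.le hs.le hL hθ N).trans
    (ENNReal.ofReal_le_ofReal (pow_le_pow_left₀ (by positivity) hN3 2))
  have h1 := hmain τ e hτ he heC μ hμ θ₀ N htail
  rw [hmass, ENNReal.ofReal_le_ofReal_iff (Real.exp_pos _).le, Real.exp_le_exp] at h1
  rcases le_total (∑ i ∈ Finset.range N, |θ₀ i / priorScale α τ i| ^ p)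
    ((τ / e) ^ (1 / α)) with hle | hle
  · left
    have h2 : m * e ^ 2 ≤ 2 * B * (τ / e) ^ (1 / α) := by
      linarith [mul_le_mul_of_nonneg_left hle hB.le]
    refine (le_of_mul_sq_le_mul_div_rpow hα hτ he hm (by positivity) h2).trans ?_
    gcongr
    exact le_max_right _ _
  · right
    refine ⟨N, hN1, ?_⟩
    have h2 : m * e ^ 2 ≤ 2 * B * ∑ i ∈ Finset.range N, |θ₀ i / priorScale α τ i| ^ p := by
      linarith [mul_le_mul_of_nonneg_left hle hB.le]
    simp_rw [abs_div_priorScale_rpow (β := β) hq0 hτ θ₀, ← Finset.mul_sum] at h2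
    set S := ∑ i ∈ Finset.range N, besovTerm β q θ₀ i ^ (1 - (q - p) / q) *
            idx i ^ (1 + p * (α - β) - (q - p) / q) with hS
    have hS0 : 0 ≤ S := Finset.sum_nonneg fun i _ =>
      mul_nonneg (Real.rpow_nonneg (besovTerm_nonneg _ _ _ _) _)
        (Real.rpow_nonneg (idx_pos i).le _)
    calc e ^ 2 = m⁻¹ * (m * e ^ 2) := by field_simp
      _ ≤ m⁻¹ * (2 * B * (τ ^ (-p) * S)) := by gcongr
      _ = 2 * B * (m * τ ^ p)⁻¹ * S := by rw [Real.rpow_neg hτ.le, mul_inv]; ring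
      _ ≤ _ := by gcongr; exact le_max_left _ _

theorem log_sqrt_rpow_nonneg {x y : ℝ} (hy : 0 ≤ y) (hy2 : y ≤ 1 / 2) :
    0 ≤ Real.log (Real.sqrt x) ^ y := by
  rcases le_or_gt 0 (Real.log (Real.sqrt x)) with h | h
  · exact Real.rpow_nonneg h _
  · rw [Real.rpow_def_of_neg h]
    refine mul_nonneg (Real.exp_pos _).le (Real.cos_nonneg_of_mem_Icc ⟨?_, ?_⟩) <;>
      nlinarith [Real.pi_pos]

/-- The polynomial regime: a sum growing like `N ^ r`. -/
theorem le_of_sq_le_mul_rpow {e A D X N r s : ℝ} (he : 0 < e) (hA : 0 ≤ A) (hD : 0 ≤ D)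
    (hX : 0 < X) (hr : 0 ≤ r) (hs : 0 < s) (hN0 : 0 ≤ N) (hN : N ≤ (D / e) ^ (1 / s))
    (h : e ^ 2 ≤ A * X⁻¹ * N ^ r) :
    e ≤ (A * D ^ (r / s)) ^ (1 / (2 + r / s)) * X ^ (-(1 / (2 + r / s))) := by
  have h1 : N ^ r ≤ D ^ (r / s) / e ^ (r / s) := by
    refine (Real.rpow_le_rpow hN0 hN hr).trans (le_of_eq ?_)
    rw [← Real.rpow_mul (by positivity), Real.div_rpow hD he.le, one_div_mul_eq_div]
  have h2 : e ^ (2 + r / s) ≤ A * D ^ (r / s) * X⁻¹ := by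
    rw [Real.rpow_add he, Real.rpow_two]
    calc e ^ 2 * e ^ (r / s)
        ≤ A * X⁻¹ * (D ^ (r / s) / e ^ (r / s)) * e ^ (r / s) := by
          gcongr
          exact h.trans (by gcongr)
      _ = _ := by field_simp
  have h3 := le_of_rpow_le_mul he (by positivity) (by positivity) (by positivity) h2
  rwa [Real.inv_rpow hX.le, ← Real.rpow_neg hX.le] at h3

theorem le_of_mul_rpow_le {p α τ m M : ℝ} (hp : 1 ≤ p) (hp2 : p ≤ 2) (hα : 0 < α)
    (hτ : 0 < τ) (hm : 1 ≤ m) (hM : 1 ≤ M) (h : m * τ ^ p ≤ M) :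
    τ ≤ M ^ (2 * (α / (1 + 2 * α))) * (m ^ (-(α / (1 + 2 * α))) * τ ^ (1 / (1 + 2 * α))) := by
  have hτM : τ ≤ M := by
    rcases le_total τ 1 with h1 | h1
    · exact h1.trans hM
    · calc τ = τ ^ (1 : ℝ) := (Real.rpow_one τ).symm
        _ ≤ τ ^ p := Real.rpow_le_rpow_of_exponent_le h1 hp
        _ ≤ m * τ ^ p := le_mul_of_one_le_left (by positivity) hm
        _ ≤ M := h
  have h2 : m * τ ^ (2 : ℝ) ≤ M ^ (2 : ℝ) := by
    calc m * τ ^ (2 : ℝ) = m * τ ^ p * τ ^ (2 - p) := by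
          rw [mul_assoc, ← Real.rpow_add hτ, add_sub_cancel]
      _ ≤ M * M ^ (1 : ℝ) := by
          gcongr
          exact (Real.rpow_le_rpow hτ.le hτM (by linarith)).trans
            (Real.rpow_le_rpow_of_exponent_le hM (by linarith))
      _ = M ^ (2 : ℝ) := by rw [Real.rpow_one, Real.rpow_two, sq]
  set u := α / (1 + 2 * α) with hu
  have hu0 : 0 ≤ u := by positivity
  have h3 := Real.rpow_le_rpow (by positivity) h2 hu0
  rw [Real.mul_rpow (by positivity) (by positivity), ← Real.rpow_mul hτ.le,
    ← Real.rpow_mul (by linarith)] at h3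
  have h4 : τ = m ^ (-u) * (m ^ u * τ ^ (2 * u)) * τ ^ (1 / (1 + 2 * α)) := by
    rw [← mul_assoc, ← Real.rpow_add (by linarith), neg_add_cancel, Real.rpow_zero, one_mul,
      ← Real.rpow_add hτ]
    have : 2 * u + 1 / (1 + 2 * α) = 1 := by
      rw [hu]
      field_simp
      ring
    rw [this, Real.rpow_one]
  calc τ = m ^ (-u) * (m ^ u * τ ^ (2 * u)) * τ ^ (1 / (1 + 2 * α)) := h4
    _ ≤ m ^ (-u) * M ^ (2 * u) * τ ^ (1 / (1 + 2 * α)) := by gcongr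
    _ = _ := by ring

theorem one_add_log_le {D s X N : ℝ} (hD : 0 < D) (hs : 0 < s) (hX : Real.exp 2 ≤ X)
    (hN0 : 0 ≤ N) (hN : N ≤ (D * Real.sqrt X) ^ (1 / s)) :
    1 + Real.log N ≤ (1 + 1 / s * (|Real.log D| + 1)) * Real.log (Real.sqrt X) := by
  have hX0 : 0 < X := (Real.exp_pos 2).trans_le hX
  have hl : 1 ≤ Real.log (Real.sqrt X) := by
    rw [Real.log_sqrt hX0.le]
    have := (Real.le_log_iff_exp_le hX0).2 hX
    linarith
  rcases hN0.eq_or_lt with h0 | h0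
  · rw [← h0, Real.log_zero, add_zero]
    have : 0 ≤ 1 / s * (|Real.log D| + 1) := by positivity
    nlinarith
  · have h1 : Real.log N ≤ 1 / s * (Real.log D + Real.log (Real.sqrt X)) := by
      rw [← Real.log_mul hD.ne' (Real.sqrt_pos.2 hX0).ne', ← Real.log_rpow (by positivity)]
      exact Real.log_le_log h0 hN
    have h2 : Real.log D ≤ |Real.log D| * Real.log (Real.sqrt X) :=
      (le_abs_self _).trans (le_mul_of_one_le_right (abs_nonneg _) hl)
    calc 1 + Real.log N ≤ Real.log (Real.sqrt X) +
          1 / s * (|Real.log D| * Real.log (Real.sqrt X) + Real.log (Real.sqrt X)) := by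
          refine add_le_add hl (h1.trans ?_)
          gcongr
      _ = _ := by ring

/-- The logarithmic regime: a sum growing like `(1 + log N) ^ γ`. -/
theorem le_of_sq_le_mul_log {e A D X N γ s : ℝ} (he : 0 < e) (hA : 0 ≤ A) (hD : 0 < D)
    (hX : Real.exp 2 ≤ X) (hγ : 0 ≤ γ) (hs : 0 < s) (hN0 : 0 ≤ N) (hN1 : 0 ≤ 1 + Real.log N)
    (hN : N ≤ (D / e) ^ (1 / s)) (h : e ^ 2 ≤ A * X⁻¹ * (1 + Real.log N) ^ γ) :
    e ≤ (1 + (A * (1 + 1 / s * (|Real.log D| + 1)) ^ γ) ^ (1 / 2 : ℝ)) *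
      (X ^ (-(1 / 2) : ℝ) * Real.log (Real.sqrt X) ^ (γ / 2)) := by
  have hX0 : 0 < X := (Real.exp_pos 2).trans_le hX
  have hl : 1 ≤ Real.log (Real.sqrt X) := by
    rw [Real.log_sqrt hX0.le]
    have := (Real.le_log_iff_exp_le hX0).2 hX
    linarith
  set ℓ := Real.log (Real.sqrt X) with hℓ
  set c := 1 + 1 / s * (|Real.log D| + 1) with hc
  have hc0 : 0 < c := by positivity
  have hsX : X ^ (-(1 / 2) : ℝ) = (Real.sqrt X)⁻¹ := by
    rw [Real.rpow_neg hX0.le, Real.sqrt_eq_rpow]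
  rcases le_total e (X ^ (-(1 / 2) : ℝ)) with h0 | h0
  · calc e ≤ 1 * (X ^ (-(1 / 2) : ℝ) * 1) := by simpa using h0
      _ ≤ _ := by
        gcongr
        · have : 0 ≤ (A * c ^ γ) ^ (1 / 2 : ℝ) := by positivity
          linarith
        · exact Real.one_le_rpow hl (by linarith)
  · have hDe : N ≤ (D * Real.sqrt X) ^ (1 / s) := by
      refine hN.trans (Real.rpow_le_rpow (by positivity) ?_ (by positivity))
      rw [hsX] at h0
      rw [div_eq_mul_inv]
      gcongr
      exact inv_le_of_inv_le₀ (Real.sqrt_pos.2 hX0) h0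
    have h1 := one_add_log_le hD hs hX hN0 hDe
    have h2 : e ^ (2 : ℝ) ≤ A * c ^ γ * (X⁻¹ * ℓ ^ γ) := by
      rw [Real.rpow_two]
      refine h.trans ?_
      calc A * X⁻¹ * (1 + Real.log N) ^ γ ≤ A * X⁻¹ * (c * ℓ) ^ γ := by gcongr
        _ = _ := by rw [Real.mul_rpow hc0.le (by linarith)]; ring
    have hℓ0 : 0 < ℓ := by linarith
    have h3 := le_of_rpow_le_mul he two_pos (by positivity) (by positivity) h2
    rw [Real.mul_rpow (x := X⁻¹) (by positivity) (by positivity), Real.inv_rpow hX0.le,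
      ← Real.rpow_neg hX0.le, ← Real.rpow_mul hℓ0.le, mul_one_div] at h3
    refine h3.trans ?_
    gcongr
    linarith

theorem le_mul_add_of_or {e a b x y : ℝ} (ha : 0 ≤ a) (hb : 0 ≤ b) (hx : 0 ≤ x) (hy : 0 ≤ y)
    (h : e ≤ a * x ∨ e ≤ b * y) : e ≤ (a + b) * (x + y) := by
  have h1 := mul_nonneg ha hx
  have h2 := mul_nonneg hb hy
  have h3 := mul_nonneg ha hy
  have h4 := mul_nonneg hb hx
  rcases h with h | h <;> linarith

/-- **Lemma 3.3(ii)**: upper bounds for `ε_n(α,τ)` under Besov regularity of the truth,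
with a constant depending on `θ₀` only through `‖θ₀‖_{B^β_{qq}} ≤ L` and uniform over all `τ`
such that `ε_n(α,τ)/τ` stays bounded. -/
theorem eps_upper_bound_besov
    (K : ℝ) (hK : 0 < K)
    (p q : ℝ) (hp : 1 ≤ p) (hpq : p ≤ q) (hq : q < 2)
    (α : ℝ) (hα : 0 < α) (β : ℝ) (hβ : 1 / p ≤ β)
    -- the p-exponential priors Π(·|α,τ), τ > 0
    (Prior : ℝ → Measure (ℕ → ℝ))
    (hPrior : ∀ τ : ℝ, 0 < τ → IsPexpPrior p α τ (Prior τ)) :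
    ∀ Ctil L : ℝ, 0 < Ctil → 0 < L →
      ∃ C : ℝ, 0 < C ∧
        ∀ θ₀ : ℕ → ℝ, inBesovBall β q L θ₀ →
          ∀ eps : ℝ → ℕ → ℝ,
            -- eps τ n = ε_n(α,τ): the solution of the small-ball equation
            (∀ τ : ℝ, 0 < τ → ∀ n : ℕ, 1 ≤ n → 0 < eps τ n ∧
              Prior τ {θ | l2norm (fun i => θ i - θ₀ i) ≤ K * eps τ n} =
                ENNReal.ofReal (Real.exp (-(n : ℝ) * (eps τ n) ^ 2))) →
            ∀ τ : ℝ, 0 < τ → ∀ n : ℕ, 1 ≤ n →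
              eps τ n ≤ Ctil * τ →
              eps τ n ≤ C * epsTildeBesov p q α β n τ := by
  intro Ctil L hC hL
  have hp0 : 0 < p := by linarith
  have hq0 : 0 < q := by linarith
  have hs : 0 < β + 1 / 2 - 1 / q := by
    have : 1 / q ≤ 1 / p := one_div_le_one_div_of_le hp0 hpq
    linarith
  have hγ : 0 ≤ (q - p) / q := div_nonneg (by linarith) hq0.le
  have hγ1 : (q - p) / q < 1 := by
    rw [div_lt_one hq0]
    linarith
  have hM0 : 0 < L ^ q := by positivity
  obtain ⟨B, hB, hmain⟩ := le_of_smallBall_eq (K := K) hp hpq hq hα hs hK hC hL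
  have hB0 := hB.le
  set s := β + 1 / 2 - 1 / q with hsd
  have hD : 0 < 2 * L / K := by positivity
  have hpβ : p * (α + 1 / p - β) = 1 + p * (α - β) := by
    field_simp
    ring
  rcases lt_trichotomy β (α + 1 / p) with hβα | hβα | hβα
  · have hr : 0 < 1 + p * (α - β) := by
      rw [← hpβ]
      exact mul_pos hp0 (by linarith)
    obtain ⟨c, hc, hsum⟩ := exists_weighted_sum_le_of_pos hγ hγ1 hM0 hr
    set r := 1 + p * (α - β) with hrd
    refine ⟨B + (B * c * (2 * L / K) ^ (r / s)) ^ (1 / (2 + r / s)), by positivity, ?_⟩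
    intro θ₀ hθ eps heps τ hτ n hn he
    obtain ⟨he0, hmass⟩ := heps τ hτ n hn
    have hn0 : (0 : ℝ) < n := by exact_mod_cast hn
    rw [epsTildeBesov, if_pos hβα]
    refine le_mul_add_of_or hB0 (by positivity) (by positivity) (by positivity) ?_
    refine (hmain τ _ n hτ he0 hn0 he _ (hPrior τ hτ) θ₀ hθ hmass).imp_right ?_
    rintro ⟨N, hN, h⟩
    rw [← div_div] at hN
    have h1 := hsum _ (besovTerm_nonneg β q θ₀) N (sum_besovTerm_le hq0 hθ _)
    have h2 : eps τ n ^ 2 ≤ B * c * ((n : ℝ) * τ ^ p)⁻¹ * (N : ℝ) ^ r :=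
      h.trans ((mul_le_mul_of_nonneg_left h1 (by positivity)).trans (le_of_eq (by ring)))
    have h3 := le_of_sq_le_mul_rpow he0 (by positivity) hD.le (by positivity) hr.le hs
      N.cast_nonneg hN h2
    have h4 : 1 / (2 + r / s) =
        (2 * β * q + q - 2) / (4 * β * q + 4 * q - 4 - 2 * β * p * q + 2 * α * p * q) := by
      have e1 : 2 * β * q + q - 2 = 2 * q * s := by
        rw [hsd]
        field_simp
      have e2 : 4 * β * q + 4 * q - 4 - 2 * β * p * q + 2 * α * p * q =
          2 * q * (2 * s + r) := by
        rw [hsd, hrd]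
        field_simp
        ring
      rw [e1, e2]
      field_simp
    rwa [← h4]
  · have hr : 1 + p * (α - β) = 0 := by
      rw [← hpβ, hβα, sub_self, mul_zero]
    rw [hr] at hmain
    simp only [zero_sub] at hmain
    set γ := (q - p) / q with hγd
    have hγ2 : (q - p) / (2 * q) = γ / 2 := by
      rw [hγd, div_div, mul_comm]
    set A := B * (L ^ q) ^ (1 - γ) with hA
    set D := 2 * L / K with hDd
    refine ⟨max B (Ctil * Real.exp 2 ^ (2 * (α / (1 + 2 * α)))) +
      (1 + (A * (1 + 1 / s * (|Real.log D| + 1)) ^ γ) ^ (1 / 2 : ℝ)), by positivity, ?_⟩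
    intro θ₀ hθ eps heps τ hτ n hn he
    obtain ⟨he0, hmass⟩ := heps τ hτ n hn
    have hn1 : (1 : ℝ) ≤ n := by exact_mod_cast hn
    have hn0 : (0 : ℝ) < n := by linarith
    have hX0 : 0 < (n : ℝ) * τ ^ p := by positivity
    rw [epsTildeBesov, if_neg hβα.not_lt, if_neg hβα.symm.not_lt, hγ2]
    refine le_mul_add_of_or (by positivity) (by positivity) (by positivity)
      (mul_nonneg (by positivity) (log_sqrt_rpow_nonneg (by positivity) (by linarith))) ?_
    rcases le_total ((n : ℝ) * τ ^ p) (Real.exp 2) with hX | hX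
    · left
      have h1 := le_of_mul_rpow_le hp (hpq.trans hq.le) hα hτ hn1
        (Real.one_le_exp zero_le_two) hX
      calc eps τ n ≤ Ctil * τ := he
        _ ≤ Ctil * _ := mul_le_mul_of_nonneg_left h1 hC.le
        _ = _ := (mul_assoc _ _ _).symm
        _ ≤ _ := mul_le_mul_of_nonneg_right (le_max_right _ _) (by positivity)
    · rcases hmain τ _ n hτ he0 hn0 he _ (hPrior τ hτ) θ₀ hθ hmass with h | ⟨N, hN, h⟩
      · exact Or.inl (h.trans (mul_le_mul_of_nonneg_right (le_max_left _ _) (by positivity)))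
      · right
        rw [← div_div] at hN
        have hN1 : 0 ≤ 1 + Real.log N := by
          linarith [Real.log_natCast_nonneg N]
        have h1 := weighted_sum_le_log hγ hγ1 hM0 (besovTerm_nonneg β q θ₀) N
          (sum_besovTerm_le hq0 hθ _)
        refine le_of_sq_le_mul_log he0 (by positivity) hD hX hγ hs N.cast_nonneg hN1 hN ?_
        exact h.trans ((mul_le_mul_of_nonneg_left h1 (by positivity)).trans
          (le_of_eq (by rw [hA]; ring)))
  · have hr : 1 + p * (α - β) < 0 := by
      rw [← hpβ]
      exact mul_neg_of_pos_of_neg hp0 (by linarith)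
    obtain ⟨c, hc, hsum⟩ := exists_weighted_sum_le_of_neg hγ hγ1 hM0 hr
    refine ⟨B + (B * c) ^ (1 / 2 : ℝ), by positivity, ?_⟩
    intro θ₀ hθ eps heps τ hτ n hn he
    obtain ⟨he0, hmass⟩ := heps τ hτ n hn
    have hn0 : (0 : ℝ) < n := by exact_mod_cast hn
    have hX0 : 0 < (n : ℝ) * τ ^ p := by positivity
    rw [epsTildeBesov, if_neg hβα.not_gt, if_pos hβα]
    refine le_mul_add_of_or hB0 (by positivity) (by positivity) (by positivity) ?_
    refine (hmain τ _ n hτ he0 hn0 he _ (hPrior τ hτ) θ₀ hθ hmass).imp_right ?_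
    rintro ⟨N, -, h⟩
    have h1 := hsum _ (besovTerm_nonneg β q θ₀) N (sum_besovTerm_le hq0 hθ _)
    have h2 : eps τ n ^ (2 : ℝ) ≤ B * c * ((n : ℝ) * τ ^ p)⁻¹ := by
      rw [Real.rpow_two]
      exact h.trans ((mul_le_mul_of_nonneg_left h1 (by positivity)).trans (le_of_eq (by ring)))
    have h3 := le_of_rpow_le_mul he0 two_pos (by positivity) (by positivity) h2
    rwa [Real.inv_rpow hX0.le, ← Real.rpow_neg hX0.le] at h3
end
end

section
/- Optimization of the upper bound ε̃_n(α,1) over the regularity α for a Sobolev truth (Lemma 3.4(ii)): Let p ∈ [1,2] and β > 0, and fix τ = 1. Let ε̃_n(α,1) be as in Lemma 3.3(i). Then there exist constants c, C > 0 (depending only on β, p and ‖θ₀‖_{H^β}) such that for all sufficiently large n: (a) ε̃_n(α,1) ≥ c·n^{−β/(1+2β)} for every α > 0; and (b) c·n^{−β/(1+2β)} ≤ ε̃_n(β,1) ≤ C·n^{−β/(1+2β)}, i.e. the choice α = β attains (up to constants) the minimax rate n^{−β/(1+2β)}. -/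
noncomputable section

/-- The upper bound `ε̃_n(α,τ)` of Lemma 3.3(i), for a Sobolev truth of regularity `β`. -/
def epsTildeSob (p α β : ℝ) (n : ℕ) (τ : ℝ) : ℝ :=
  (n : ℝ) ^ (-(α / (1 + 2 * α))) * τ ^ (1 / (1 + 2 * α)) +
    (if β < α + 1 / p then ((n : ℝ) * τ ^ p) ^ (β / (β * (p - 2) - α * p - 1))
     else if α + 1 / p < β then ((n : ℝ) * τ ^ p) ^ (-(1 / 2) : ℝ)
     else ((n : ℝ) * τ ^ p) ^ (-(1 / 2) : ℝ) *
       Real.log (Real.sqrt ((n : ℝ) * τ ^ p)) ^ ((1 : ℝ) / 2 - p / 4))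

/-- **Lemma 3.4(ii)**: for fixed `τ = 1`, the upper bounds `ε̃_n(α,1)` are minimized (up to
constants) over the regularity `α` at `α = β`, attaining the minimax rate `n^{−β/(1+2β)}`. -/
theorem epsTilde_optimize_alpha
    (p : ℝ) (hp : p ∈ Set.Icc (1 : ℝ) 2) (β : ℝ) (hβ : 0 < β) :
    ∃ c C : ℝ, 0 < c ∧ 0 < C ∧ ∃ N : ℕ, 0 < N ∧ ∀ n ≥ N,
      -- (a): ε̃_n(α,1) ≳ n^{−β/(1+2β)} for every α > 0
      (∀ α : ℝ, 0 < α →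
        c * (n : ℝ) ^ (-(β / (1 + 2 * β))) ≤ epsTildeSob p α β n 1) ∧
      -- (b): the choice α = β attains the minimax rate up to constants
      (c * (n : ℝ) ^ (-(β / (1 + 2 * β))) ≤ epsTildeSob p β β n 1 ∧
        epsTildeSob p β β n 1 ≤ C * (n : ℝ) ^ (-(β / (1 + 2 * β)))) := by
  obtain ⟨hp1, -⟩ := hp
  have hpinv : 0 < 1 / p := by positivity
  have lower : ∀ n : ℕ, 1 ≤ n → ∀ α : ℝ, 0 < α →
      (1 : ℝ) * (n : ℝ) ^ (-(β / (1 + 2 * β))) ≤ epsTildeSob p α β n 1 := by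
    intro n hn α hα
    have hn' : (1 : ℝ) ≤ n := by exact_mod_cast hn
    unfold epsTildeSob
    simp only [Real.one_rpow, mul_one, one_mul]
    rcases le_or_gt α β with h | h
    · have hfirst : (n : ℝ) ^ (-(β / (1 + 2 * β))) ≤ (n : ℝ) ^ (-(α / (1 + 2 * α))) := by
        apply Real.rpow_le_rpow_of_exponent_le hn'
        rw [neg_le_neg_iff, div_le_div_iff₀ (by linarith) (by linarith)]
        nlinarith
      have hlog : 0 ≤ Real.log (Real.sqrt n) := Real.log_nonneg (Real.one_le_sqrt.mpr hn')
      refine hfirst.trans (le_add_of_nonneg_right ?_)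
      split_ifs <;> positivity
    · rw [if_pos (by linarith)]
      have hden : 1 + 2 * β ≤ 1 + α * p + β * (2 - p) := by nlinarith
      have hexp : β / (β * (p - 2) - α * p - 1) = -(β / (1 + α * p + β * (2 - p))) := by
        rw [← div_neg]
        congr 1
        ring
      refine le_add_of_nonneg_of_le (by positivity) ?_
      apply Real.rpow_le_rpow_of_exponent_le hn'
      rw [hexp, neg_le_neg_iff]
      gcongr
  refine ⟨1, 2, one_pos, two_pos, 1, one_pos, fun n hn => ⟨lower n hn, lower n hn β hβ, ?_⟩⟩
  have hexp : β / (β * (p - 2) - β * p - 1) = -(β / (1 + 2 * β)) := by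
    rw [← div_neg]
    congr 1
    ring
  unfold epsTildeSob
  rw [if_pos (by linarith), hexp]
  simp only [Real.one_rpow, mul_one]
  exact (two_mul _).ge
end
end
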